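/- Fix n ≥ 2. If every stable lattice x ∈ ℒ_n satisfies covrad(x) ≤ √n/2, then Minkowski's conjecture holds in dimension n: every unimodular lattice x in ℝⁿ satisfies sup_{u∈ℝⁿ} inf_{v∈x} |∏_{i=1}^n (u_i − v_i)| ≤ 2^{−n}. -/

import Mathlib

open scoped BigOperators
open Matrix Topology Filter

noncomputable section

namespace SW

/-! ### Euclidean structure on `Fin n → ℝ` -/

/-- The standard Euclidean inner product on `Fin n → ℝ`. -/
def einner {n : ℕ} (v w : Fin n → ℝ) : ℝ := ∑ i, v i * w i

/-- The Euclidean norm on `Fin n → ℝ`. -/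
def enorm {n : ℕ} (v : Fin n → ℝ) : ℝ := Real.sqrt (∑ i, v i ^ 2)

lemma einner_add_left {n : ℕ} (u v w : Fin n → ℝ) :
    einner (u + v) w = einner u w + einner v w := by
  simp [einner, add_mul, Finset.sum_add_distrib]

lemma einner_neg_left {n : ℕ} (u w : Fin n → ℝ) : einner (-u) w = -einner u w := by
  simp [einner]

lemma einner_smul_left {n : ℕ} (c : ℝ) (u w : Fin n → ℝ) :
    einner (c • u) w = c * einner u w := by
  simp [einner, Finset.mul_sum, mul_assoc]

/-! ### Covolume, rank, lattices, stability -/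

/-- `√(det Gram)` of a finite family of vectors: the covolume of the ℤ-span of the family
(in the span of the family) when the family is linearly independent. -/
def gvol {n r : ℕ} (v : Fin r → (Fin n → ℝ)) : ℝ :=
  Real.sqrt (Matrix.det (Matrix.of fun i j => einner (v i) (v j)))

/-- `c` is the covolume of `Λ` in its real span, as computed from some ℤ-basis of `Λ` which is
linearly independent over `ℝ`. -/
def covolSpec {n : ℕ} (Λ : AddSubgroup (Fin n → ℝ)) (c : ℝ) : Prop :=
  ∃ (r : ℕ) (v : Fin r → (Fin n → ℝ)), LinearIndependent ℝ v ∧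
    Λ = AddSubgroup.closure (Set.range v) ∧ c = gvol v

/-- The covolume of a discrete subgroup `Λ ⊆ ℝⁿ` inside its real span (with `covol ⊥ = 1`). -/
def covol {n : ℕ} (Λ : AddSubgroup (Fin n → ℝ)) : ℝ := sInf {c | covolSpec Λ c}

/-- The rank of a discrete subgroup of `ℝⁿ`: the dimension of its real span. -/
def rk {n : ℕ} (Λ : AddSubgroup (Fin n → ℝ)) : ℕ :=
  Module.finrank ℝ (Submodule.span ℝ (Λ : Set (Fin n → ℝ)))

/-- A lattice in `ℝⁿ`: a discrete subgroup spanning `ℝⁿ` (equivalently, cocompact). -/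
def IsLattice {n : ℕ} (L : AddSubgroup (Fin n → ℝ)) : Prop :=
  DiscreteTopology ↥L ∧ Submodule.span ℝ (L : Set (Fin n → ℝ)) = ⊤

/-- A unimodular lattice: a lattice of covolume one. -/
def IsUnimodularLattice {n : ℕ} (L : AddSubgroup (Fin n → ℝ)) : Prop :=
  IsLattice L ∧ covol L = 1

/-- A stable lattice: a unimodular lattice all of whose subgroups have covolume at least one. -/
def IsStable {n : ℕ} (L : AddSubgroup (Fin n → ℝ)) : Prop :=
  IsUnimodularLattice L ∧ ∀ Λ : AddSubgroup (Fin n → ℝ), Λ ≤ L → 1 ≤ covol Λ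

/-! ### Matrices: the diagonal group `A`, `SL_n(ℤ)`, lattices from matrices -/

/-- The group `A` of positive diagonal matrices of determinant one (as a set of matrices). -/
def Apos (n : ℕ) : Set (Matrix (Fin n) (Fin n) ℝ) :=
  {a | ∃ d : Fin n → ℝ, (∀ i, 0 < d i) ∧ (∏ i, d i) = 1 ∧ a = Matrix.diagonal d}

/-- `SL_n(ℤ)` viewed as a set of real matrices. -/
def Gam (n : ℕ) : Set (Matrix (Fin n) (Fin n) ℝ) :=
  {γ | γ.det = 1 ∧ ∀ i j, ∃ m : ℤ, γ i j = (m : ℝ)}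

/-- The lattice `g·ℤⁿ` associated to a matrix `g`. -/
def latticeOf {n : ℕ} (g : Matrix (Fin n) (Fin n) ℝ) : AddSubgroup (Fin n → ℝ) :=
  AddSubgroup.closure (Set.range fun m : Fin n → ℤ => g.mulVec fun i => (m i : ℝ))

/-- The image `g·L` of a lattice under a matrix. -/
def mapLat {n : ℕ} (g : Matrix (Fin n) (Fin n) ℝ) (L : AddSubgroup (Fin n → ℝ)) :
    AddSubgroup (Fin n → ℝ) :=
  AddSubgroup.map (Matrix.mulVecLin g).toAddMonoidHom L

/-- The full preimage `A·g·Γ` in `SL_n(ℝ)` of the orbit `A·[g] ⊆ ℒ_n`; a point `[h] ∈ ℒ_n`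
lies in the closure of `A·[g]` iff `h ∈ closure (AOrbit g)`. -/
def AOrbit {n : ℕ} (g : Matrix (Fin n) (Fin n) ℝ) : Set (Matrix (Fin n) (Fin n) ℝ) :=
  {p | ∃ a ∈ Apos n, ∃ γ ∈ Gam n, p = a * g * γ}

/-- The orbit `A·[g] ⊆ ℒ_n` is bounded (has compact closure). -/
def HasBoundedAOrbit {n : ℕ} (g : Matrix (Fin n) (Fin n) ℝ) : Prop :=
  ∃ K : Set (Matrix (Fin n) (Fin n) ℝ), IsCompact K ∧
    ∀ a ∈ Apos n, ∃ γ ∈ Gam n, a * g * γ ∈ K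

/-! ### `α`, `Min_δ`, `V_δ`, `dim_δ` -/

/-- `α(x) = min { |Λ|^{1/r(Λ)} : Λ a nonzero subgroup of x }`. -/
def alpha {n : ℕ} (x : AddSubgroup (Fin n → ℝ)) : ℝ :=
  sInf {c | ∃ Λ : AddSubgroup (Fin n → ℝ), Λ ≤ x ∧ Λ ≠ ⊥ ∧ c = covol Λ ^ ((rk Λ : ℝ)⁻¹)}

/-- `α_k(x) = min { |Λ|^{1/k} : Λ a rank-`k` subgroup of x }`. -/
def alphak {n : ℕ} (k : ℕ) (x : AddSubgroup (Fin n → ℝ)) : ℝ :=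
  sInf {c | ∃ Λ : AddSubgroup (Fin n → ℝ), Λ ≤ x ∧ rk Λ = k ∧ c = covol Λ ^ ((k : ℝ)⁻¹)}

/-- `Min_δ(x)`: nonzero subgroups nearly attaining `α(x)`. -/
def MinSet {n : ℕ} (δ : ℝ) (x : AddSubgroup (Fin n → ℝ)) : Set (AddSubgroup (Fin n → ℝ)) :=
  {Λ | Λ ≤ x ∧ Λ ≠ ⊥ ∧ covol Λ ^ ((rk Λ : ℝ)⁻¹) < (1 + δ) * alpha x}

/-- `V_δ(x)`: the span of the subgroups in `Min_δ(x)`. -/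
def Vdelta {n : ℕ} (δ : ℝ) (x : AddSubgroup (Fin n → ℝ)) : Submodule ℝ (Fin n → ℝ) :=
  Submodule.span ℝ (⋃ Λ ∈ MinSet δ x, (Λ : Set (Fin n → ℝ)))

/-- `dim_δ(x) = dim V_δ(x)`. -/
def dimdelta {n : ℕ} (δ : ℝ) (x : AddSubgroup (Fin n → ℝ)) : ℕ :=
  Module.finrank ℝ (Vdelta δ x)

/-- `U_k^{x,ε} ⊆ A`: those `a` for which `δ ↦ dim_δ(ax)` equals `k` near `kε`. -/
def Uset {n : ℕ} (x : AddSubgroup (Fin n → ℝ)) (ε : ℝ) (k : ℕ) :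
    Set (Matrix (Fin n) (Fin n) ℝ) :=
  {a | a ∈ Apos n ∧ ∃ s ∈ 𝓝 ((k : ℝ) * ε), ∀ δ ∈ s, dimdelta δ (mapLat a x) = k}

/-- Logarithmic coordinates on the diagonal group. -/
def logCoord {n : ℕ} (a : Matrix (Fin n) (Fin n) ℝ) : Fin n → ℝ := fun i => Real.log (a i i)

/-! ### Covering radius -/

/-- The covering radius `covrad(L) = sup_u inf_{v ∈ L} ‖u - v‖`. -/
def covrad {n : ℕ} (L : AddSubgroup (Fin n → ℝ)) : ℝ :=
  ⨆ u : Fin n → ℝ, ⨅ v : L, enorm (u - (v : Fin n → ℝ))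

/-- `[g]` is a local maximum of `covrad : ℒ_d → ℝ` (phrased via the open quotient
`SL_d(ℝ) → ℒ_d`). -/
def IsLocalMaxCovrad {d : ℕ} (g : Matrix (Fin d) (Fin d) ℝ) : Prop :=
  ∃ W ∈ 𝓝 g, ∀ g' ∈ W, Matrix.det g' = 1 → covrad (latticeOf g') ≤ covrad (latticeOf g)

/-! ### Block upper triangular form -/

/-- Offset of the `i`-th diagonal block. -/
def off {k : ℕ} (ns : Fin k → ℕ) (i : Fin k) : ℕ :=
  ∑ j ∈ Finset.univ.filter (fun j => j < i), ns j

lemma off_add_lt {k : ℕ} (ns : Fin k → ℕ) (i : Fin k) (a : Fin (ns i)) :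
    off ns i + (a : ℕ) < ∑ j, ns j := by
  unfold off
  have hins : i ∉ Finset.univ.filter (fun j => j < i) := by simp
  have h2 : ∑ j ∈ insert i (Finset.univ.filter (fun j => j < i)), ns j ≤ ∑ j, ns j :=
    Finset.sum_le_sum_of_subset (Finset.subset_univ _)
  rw [Finset.sum_insert hins] at h2
  have := a.isLt
  omega

/-- The position, in `Fin n`, of the `a`-th coordinate of the `i`-th block. -/
def blockEmb {n k : ℕ} (ns : Fin k → ℕ) (hsum : (∑ j, ns j) = n) (i : Fin k)
    (a : Fin (ns i)) : Fin n :=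
  ⟨off ns i + (a : ℕ), hsum ▸ off_add_lt ns i a⟩

/-- `g` is block upper triangular with diagonal blocks `G i` (block sizes `ns`). -/
def IsBlockUT {n k : ℕ} (ns : Fin k → ℕ) (hsum : (∑ j, ns j) = n)
    (g : Matrix (Fin n) (Fin n) ℝ) (G : ∀ i, Matrix (Fin (ns i)) (Fin (ns i)) ℝ) : Prop :=
  (∀ (i : Fin k) (a b : Fin (ns i)),
      g (blockEmb ns hsum i a) (blockEmb ns hsum i b) = G i a b) ∧
  (∀ (i j : Fin k) (a : Fin (ns i)) (b : Fin (ns j)), j < i →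
      g (blockEmb ns hsum i a) (blockEmb ns hsum j b) = 0)

/-! ### Mordell constant -/

/-- The symmetric box `[-a₁,a₁] × ⋯ × [-aₙ,aₙ]` is admissible for `L`: its interior contains
no nonzero point of `L`. -/
def IsAdmissibleBox {n : ℕ} (L : AddSubgroup (Fin n → ℝ)) (a : Fin n → ℝ) : Prop :=
  (∀ i, 0 < a i) ∧ ∀ v ∈ L, v ≠ 0 → ∃ i, a i ≤ |v i|

/-- The Mordell constant `κ(L) = 2⁻ⁿ sup { Vol(B) : B admissible symmetric box for L }`. -/
def mordellConst {n : ℕ} (L : AddSubgroup (Fin n → ℝ)) : ℝ :=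
  (1 / 2 ^ n) * sSup {V | ∃ a : Fin n → ℝ, IsAdmissibleBox L a ∧ V = ∏ i, 2 * a i}

/-! ### Hermite constant -/

/-- Length of a shortest nonzero vector of `L`. -/
def shortest {m : ℕ} (L : AddSubgroup (Fin m → ℝ)) : ℝ :=
  sInf {t | ∃ w ∈ L, w ≠ 0 ∧ t = enorm w}

/-- The Hermite constant `γ_m`. -/
def hermiteConst (m : ℕ) : ℝ :=
  sSup {c | ∃ L : AddSubgroup (Fin m → ℝ), IsUnimodularLattice L ∧ c = shortest L ^ 2}

/-! ### Korkine–Zolotarev reduction -/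

/-- `v 0, …, v (n-1)` is a Korkine–Zolotarev reduced basis of `x`: it is a ℤ-basis, and for
each `i` the orthogonal projection of `v i` onto `span(v 0, …, v (i-1))^⊥` is shortest among the
nonzero such projections of vectors of `x` (projection lengths are expressed through Gram
determinants: the projection of `w` has length `gvol (v 0, …, v (i-1), w) / gvol (v 0, …, v (i-1))`). -/
def IsKZBasis {n : ℕ} (x : AddSubgroup (Fin n → ℝ)) (v : ℕ → (Fin n → ℝ)) : Prop :=
  LinearIndependent ℝ (fun j : Fin n => v (j : ℕ)) ∧
  x = AddSubgroup.closure (v '' Set.Iio n) ∧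
  ∀ i < n, ∀ w ∈ x, w ∉ Submodule.span ℝ (v '' Set.Iio i) →
    gvol (Fin.snoc (fun j : Fin i => v (j : ℕ)) (v i)) ≤
      gvol (Fin.snoc (fun j : Fin i => v (j : ℕ)) w)

/-- `A 0, …, A (n-1)` are the diagonal Korkine–Zolotarev coefficients of `x`: the lengths of
the successive orthogonal projections in a KZ reduced basis, i.e.
`A i = gvol (v 0, …, v i) / gvol (v 0, …, v (i-1))`. -/
def HasKZCoeffs {n : ℕ} (x : AddSubgroup (Fin n → ℝ)) (A : ℕ → ℝ) : Prop :=
  ∃ v : ℕ → (Fin n → ℝ), IsKZBasis x v ∧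
    ∀ i < n, A i * gvol (fun j : Fin i => v (j : ℕ)) = gvol (fun j : Fin (i + 1) => v (j : ℕ))

/-! ### Orthogonal complements and projections of lattices -/

/-- The orthogonal complement of a subspace `V ⊆ ℝⁿ`. -/
def orthoC {n : ℕ} (V : Submodule ℝ (Fin n → ℝ)) : Submodule ℝ (Fin n → ℝ) where
  carrier := {w | ∀ v ∈ V, einner w v = 0}
  zero_mem' := by intro v hv; simp [einner]
  add_mem' := by intro a b ha hb v hv; rw [einner_add_left, ha v hv, hb v hv, add_zero]
  smul_mem' := by intro c w hw v hv; rw [einner_smul_left, hw v hv, mul_zero]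

/-- The image `π(x)` of `x` under the orthogonal projection `π : ℝⁿ → V^⊥`:
`p = π(u)` iff `p ⊥ V` and `u - p ∈ V`. -/
def projLat {n : ℕ} (V : Submodule ℝ (Fin n → ℝ)) (x : AddSubgroup (Fin n → ℝ)) :
    AddSubgroup (Fin n → ℝ) where
  carrier := {p | (∀ v ∈ V, einner p v = 0) ∧ ∃ u ∈ x, u - p ∈ V}
  zero_mem' := ⟨by intro v hv; simp [einner], 0, x.zero_mem, by rw [sub_zero]; exact V.zero_mem⟩
  add_mem' := by
    rintro p q ⟨hp1, u1, hu1, hp2⟩ ⟨hq1, u2, hu2, hq2⟩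
    refine ⟨fun v hv => by rw [einner_add_left, hp1 v hv, hq1 v hv, add_zero],
      u1 + u2, x.add_mem hu1 hu2, ?_⟩
    have h : u1 + u2 - (p + q) = u1 - p + (u2 - q) := by abel
    rw [h]; exact V.add_mem hp2 hq2
  neg_mem' := by
    rintro p ⟨hp1, u, hu, hp2⟩
    refine ⟨fun v hv => by rw [einner_neg_left, hp1 v hv, neg_zero],
      -u, x.neg_mem hu, ?_⟩
    have h : -u - -p = -(u - p) := by abel
    rw [h]; exact V.neg_mem hp2

end SW

namespace Scarf

lemma card_collisions {α β : Type*} [DecidableEq α] [DecidableEq β] (S : Finset α) (f : α → β)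
    (h : S.card = (S.image f).card + 1) :
    (S.filter fun l => ∃ l' ∈ S, l' ≠ l ∧ f l' = f l).card = 2 := by
  have hni : ¬ Set.InjOn f S := by
    intro hinj
    rw [Finset.card_image_of_injOn hinj] at h
    omega
  simp only [Set.InjOn, not_forall] at hni
  obtain ⟨a, ha, b, hb, hab, hne⟩ := hni
  have ha' : a ∈ S := ha
  have hb' : b ∈ S := hb
  have key : ∀ a ∈ S, ∀ b ∈ S, f a = f b → a ≠ b → Set.InjOn f (S.erase a : Finset α) := by
    intro a ha b hb hab hne
    apply Finset.card_image_iff.1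
    have : (S.erase a).image f = S.image f := by
      apply Finset.Subset.antisymm
      · exact Finset.image_subset_image (Finset.erase_subset _ _)
      · intro y hy
        obtain ⟨z, hz, rfl⟩ := Finset.mem_image.1 hy
        by_cases hza : z = a
        · subst hza
          rw [hab]
          exact Finset.mem_image_of_mem _ (Finset.mem_erase.2 ⟨hne.symm, hb⟩)
        · exact Finset.mem_image_of_mem _ (Finset.mem_erase.2 ⟨hza, hz⟩)
    rw [this, Finset.card_erase_of_mem ha]
    omega
  have ka := key a ha' b hb' hab hne
  have kb := key b hb' a ha' hab.symm (Ne.symm hne)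
  have : (S.filter fun l => ∃ l' ∈ S, l' ≠ l ∧ f l' = f l) = {a, b} := by
    ext l
    simp only [Finset.mem_filter, Finset.mem_insert, Finset.mem_singleton]
    constructor
    · rintro ⟨hl, l', hl', hne', hf⟩
      by_contra hcon
      push Not at hcon
      by_cases hla : l' = a
      · subst hla
        exact hcon.1 (kb (by simp [hl, hcon.2]) (by simp [hne, ha']) hf.symm)
      · exact hne' (ka (by simp [hl', hla]) (by simp [hl, hcon.1]) hf)
    · rintro (rfl | rfl)
      · exact ⟨ha', b, hb', Ne.symm hne, hab.symm⟩
      · exact ⟨hb', a, ha', hne, hab⟩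
  rw [this, Finset.card_pair hne]

lemma card_eq_of_rel {α β : Type*} (S : Finset α) (U : Finset β) (V : α → β → Prop)
    (h1 : ∀ a ∈ S, ∃ b ∈ U, V a b) (h2 : ∀ b ∈ U, ∃ a ∈ S, V a b)
    (h3 : ∀ a ∈ S, ∀ b ∈ U, ∀ b' ∈ U, V a b → V a b' → b = b')
    (h4 : ∀ a ∈ S, ∀ a' ∈ S, ∀ b ∈ U, V a b → V a' b → a = a') : S.card = U.card := by
  choose f hf hV using h1
  refine Finset.card_bij f hf ?_ ?_
  · intro a ha a' ha' he
    exact h4 a ha a' ha' _ (hf a ha) (hV a ha) (he ▸ hV a' ha')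
  · intro b hb
    obtain ⟨a, ha, hab⟩ := h2 b hb
    exact ⟨a, ha, h3 a ha _ (hf a ha) _ hb (hV a ha) hab⟩

variable {T I : Type*} [Fintype T] [Fintype I] [DecidableEq T] [DecidableEq I]

/-- No `y` exceeds every element of `p.1` for all the orders indexed by `p.2`. -/
def Dominant (r : I → T → ℕ) (p : Finset T × Finset I) : Prop :=
  ∀ y : T, ∃ i ∈ p.2, ∀ x ∈ p.1, r i y ≤ r i x

def IsRoom (r : I → T → ℕ) (p : Finset T × Finset I) : Prop :=
  Dominant r p ∧ p.1.card = p.2.card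

def IsDoor (r : I → T → ℕ) (p : Finset T × Finset I) : Prop :=
  Dominant r p ∧ p.2.card = p.1.card + 1

/-- The door `d` bounds the room `p`. -/
def Adj (d p : Finset T × Finset I) : Prop :=
  (∃ x ∈ p.1, d = (p.1.erase x, p.2)) ∨ (∃ j, j ∉ p.2 ∧ d = (p.1, insert j p.2))

/-- The room `p` is obtained from the door `d` by giving up the order `l`. -/
def Via (r : I → T → ℕ) (d : Finset T × Finset I) (l : I) (p : Finset T × Finset I) : Prop :=
  p = (d.1, d.2.erase l) ∨
    ∃ x, x ∉ d.1 ∧ p = (insert x d.1, d.2) ∧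
      ∀ m ∈ d.2, m ≠ l → ∃ z ∈ d.1, r m z < r m x

def Good (r : I → T → ℕ) (d : Finset T × Finset I) (l : I) : Prop :=
  ∀ x ∈ d.1, ∃ m ∈ d.2, m ≠ l ∧ ∀ z ∈ d.1, r m x ≤ r m z

omit [Fintype T] [Fintype I] [DecidableEq T] [DecidableEq I] in
lemma dom_mono {r : I → T → ℕ} {p q : Finset T × Finset I} (h : Dominant r p) (h1 : q.1 ⊆ p.1)
    (h2 : p.2 ⊆ q.2) : Dominant r q := by
  intro y
  obtain ⟨i, hi, hx⟩ := h y
  exact ⟨i, h2 hi, fun x hx' => hx x (h1 hx')⟩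

section door
variable {r : I → T → ℕ} (hr : ∀ i, Function.Injective (r i)) {d : Finset T × Finset I}

omit [Fintype I] in
lemma exists_via (hd : IsDoor r d) {l : I} (hl : l ∈ d.2) (hg : Good r d l) :
    ∃ p, IsRoom r p ∧ Adj d p ∧ Via r d l p := by
  classical
  obtain ⟨hdom, hcard⟩ := hd
  set Y := Finset.univ.filter (fun y : T => ∀ m ∈ d.2, m ≠ l → ∃ z ∈ d.1, r m z < r m y) with hY
  rcases Y.eq_empty_or_nonempty with hYe | hYn
  · refine ⟨(d.1, d.2.erase l), ⟨?_, ?_⟩, ?_, Or.inl rfl⟩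
    · intro y
      have hy : y ∉ Y := by simp [hYe]
      simp only [hY, Finset.mem_filter, Finset.mem_univ, true_and] at hy
      push Not at hy
      obtain ⟨m, hm, hml, hz⟩ := hy
      exact ⟨m, Finset.mem_erase.2 ⟨hml, hm⟩, hz⟩
    · simp [Finset.card_erase_of_mem hl, hcard]
    · right
      exact ⟨l, by simp, by simp [Finset.insert_erase hl]⟩
  · obtain ⟨x, hx, hmax⟩ := Finset.exists_max_image Y (r l) hYn
    have hx' : ∀ m ∈ d.2, m ≠ l → ∃ z ∈ d.1, r m z < r m x := by simpa [hY] using hx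
    have hxτ : x ∉ d.1 := by
      intro hxd
      obtain ⟨m, hm, hml, hz⟩ := hg x hxd
      obtain ⟨z, hz1, hz2⟩ := hx' m hm hml
      exact absurd (hz z hz1) (not_le.2 hz2)
    refine ⟨(insert x d.1, d.2), ⟨?_, ?_⟩, ?_, Or.inr ⟨x, hxτ, rfl, hx'⟩⟩
    · intro y
      by_cases hyY : y ∈ Y
      · have hy' : ∀ m ∈ d.2, m ≠ l → ∃ z ∈ d.1, r m z < r m y := by simpa [hY] using hyY
        obtain ⟨m, hm, hz⟩ := hdom y
        have hml : m = l := by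
          by_contra hml
          obtain ⟨z, hz1, hz2⟩ := hy' m hm hml
          exact absurd (hz z hz1) (not_le.2 hz2)
        subst hml
        refine ⟨m, hm, fun z hzz => ?_⟩
        rcases Finset.mem_insert.1 hzz with rfl | h
        · exact hmax y hyY
        · exact hz z h
      · simp only [hY, Finset.mem_filter, Finset.mem_univ, true_and] at hyY
        push Not at hyY
        obtain ⟨m, hm, hml, hz⟩ := hyY
        refine ⟨m, hm, fun z hzz => ?_⟩
        rcases Finset.mem_insert.1 hzz with rfl | h
        · obtain ⟨w, hw1, hw2⟩ := hx' m hm hml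
          exact (hz w hw1).trans hw2.le
        · exact hz z h
    · simp [Finset.card_insert_of_notMem hxτ, hcard]
    · left
      exact ⟨x, by simp, by simp [Finset.erase_insert hxτ]⟩

omit [Fintype T] [Fintype I] in
include hr in
lemma via_of_adj {p : Finset T × Finset I} (hp : IsRoom r p) (ha : Adj d p) :
    ∃ l ∈ d.2, Good r d l ∧ Via r d l p := by
  obtain ⟨σ, C⟩ := p
  obtain ⟨hdom, hcard⟩ := hp
  rcases ha with ⟨x, hx, rfl⟩ | ⟨j, hj, rfl⟩
  · simp only at hx hcard
    have hm : ∀ x' : T, ∃ m ∈ C, ∀ z ∈ σ, r m x' ≤ r m z := hdom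
    choose f hfC hf using hm
    have hinj : Set.InjOn f σ := by
      intro a ha b hb hab
      have h1 := hf a b hb
      have h2 := hf b a ha
      rw [hab] at h1
      exact hr _ (le_antisymm h1 h2)
    have him : σ.image f = C := by
      apply Finset.eq_of_subset_of_card_le
      · intro m hm
        obtain ⟨y, -, rfl⟩ := Finset.mem_image.1 hm
        exact hfC y
      · rw [Finset.card_image_of_injOn hinj, hcard]
    refine ⟨f x, hfC x, ?_, ?_⟩
    · intro x' hx'
      have hx'' := Finset.mem_erase.1 hx'
      refine ⟨f x', hfC x', fun h => hx''.1 (hinj hx''.2 hx h), fun z hz => ?_⟩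
      exact hf x' z (Finset.mem_of_mem_erase hz)
    · right
      refine ⟨x, by simp, by simp [Finset.insert_erase hx], ?_⟩
      intro m hm hml
      simp only at hm
      rw [← him] at hm
      obtain ⟨y, hy, rfl⟩ := Finset.mem_image.1 hm
      have hyx : y ≠ x := fun h => hml (by rw [h])
      refine ⟨y, by simp [hy, hyx], ?_⟩
      exact lt_of_le_of_ne (hf y x hx) fun h => hyx (hr _ h)
  · simp only at hj
    refine ⟨j, by simp, ?_, ?_⟩
    · intro x _
      obtain ⟨m, hm, hz⟩ := hdom x
      exact ⟨m, by simp [show m ∈ C from hm], fun h => hj (h ▸ hm), hz⟩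
    · left
      simp [Finset.erase_insert hj]

omit [Fintype T] [Fintype I] in
include hr in
lemma via_unique {l : I} {p p' : Finset T × Finset I} (hp : IsRoom r p) (hp' : IsRoom r p')
    (hv : Via r d l p) (hv' : Via r d l p') : p = p' := by
  have aux : ∀ x, (∀ m ∈ d.2, m ≠ l → ∃ z ∈ d.1, r m z < r m x) →
      Dominant r (d.1, d.2.erase l) → False := by
    intro x hx hdom
    obtain ⟨m, hm, hz⟩ := hdom x
    obtain ⟨hml, hm⟩ := Finset.mem_erase.1 hm
    obtain ⟨z, hz1, hz2⟩ := hx m hm hml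
    exact absurd (hz z hz1) (not_le.2 hz2)
  have aux2 : ∀ x x', (∀ m ∈ d.2, m ≠ l → ∃ z ∈ d.1, r m z < r m x') →
      Dominant r (insert x d.1, d.2) → r l x' ≤ r l x := by
    intro x x' hx' hdom
    obtain ⟨m, hm, hz⟩ := hdom x'
    have hml : m = l := by
      by_contra hml
      obtain ⟨z, hz1, hz2⟩ := hx' m hm hml
      exact absurd (hz z (by simp [hz1])) (not_le.2 hz2)
    subst hml
    exact hz x (by simp)
  rcases hv with rfl | ⟨x, hx, rfl, hxx⟩ <;> rcases hv' with rfl | ⟨x', hx', rfl, hxx'⟩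
  · rfl
  · exact (aux x' hxx' hp.1).elim
  · exact (aux x hxx hp'.1).elim
  · have : x = x' := hr l (le_antisymm (aux2 _ _ hxx hp'.1) (aux2 _ _ hxx' hp.1))
    rw [this]

omit [Fintype T] [Fintype I] in
lemma via_inj (hd : IsDoor r d) {l l' : I} (hl : l ∈ d.2) (hl' : l' ∈ d.2)
    {p : Finset T × Finset I} (hv : Via r d l p) (hv' : Via r d l' p) : l = l' := by
  rcases hv with h | ⟨x, hx, h, hxx⟩ <;> rcases hv' with h' | ⟨x', hx', h', hxx'⟩
  · have : d.2.erase l = d.2.erase l' := (Prod.ext_iff.1 (h.symm.trans h')).2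
    exact Finset.erase_injOn _ hl hl' this
  · have : d.2.erase l = d.2 := (Prod.ext_iff.1 (h.symm.trans h')).2
    exact absurd hl (Finset.erase_eq_self.1 this)
  · have : d.2.erase l' = d.2 := (Prod.ext_iff.1 (h'.symm.trans h)).2
    exact absurd hl' (Finset.erase_eq_self.1 this)
  · have h1 : insert x d.1 = insert x' d.1 := (Prod.ext_iff.1 (h.symm.trans h')).1
    have hxe : x = x' := by
      have : x ∈ insert x' d.1 := h1 ▸ Finset.mem_insert_self _ _
      rcases Finset.mem_insert.1 this with h | h
      · exact h
      · exact absurd h hx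
    subst hxe
    by_contra hne
    obtain ⟨m, hm, hz⟩ := hd.1 x
    by_cases hml : m = l
    · obtain ⟨z, hz1, hz2⟩ := hxx' m hm (fun h => hne (hml ▸ h))
      exact absurd (hz z hz1) (not_le.2 hz2)
    · obtain ⟨z, hz1, hz2⟩ := hxx m hm hml
      exact absurd (hz z hz1) (not_le.2 hz2)

open Classical in
omit [Fintype T] [Fintype I] in
include hr in
lemma card_good (hd : IsDoor r d) (hne : d.1.Nonempty) :
    (d.2.filter fun l => Good r d l).card = 2 := by
  have hmin : ∀ m : I, ∃ x ∈ d.1, ∀ z ∈ d.1, r m x ≤ r m z := fun m =>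
    Finset.exists_min_image d.1 (r m) hne
  choose μ hμd hμ using hmin
  have huniq : ∀ m x, x ∈ d.1 → (∀ z ∈ d.1, r m x ≤ r m z) → μ m = x := fun m x hx hz =>
    hr m (le_antisymm (hμ m x hx) (hz _ (hμd m)))
  have him : d.2.image μ = d.1 := by
    apply Finset.Subset.antisymm
    · intro x hx
      obtain ⟨m, -, rfl⟩ := Finset.mem_image.1 hx
      exact hμd m
    · intro x hx
      obtain ⟨m, hm, hz⟩ := hd.1 x
      exact Finset.mem_image.2 ⟨m, hm, huniq m x hx hz⟩
  rw [← card_collisions d.2 μ (by rw [him]; exact hd.2)]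
  congr 1
  apply Finset.filter_congr
  intro l hl
  constructor
  · intro hg
    obtain ⟨m, hm, hml, hz⟩ := hg (μ l) (hμd l)
    exact ⟨m, hm, hml, huniq m _ (hμd l) hz⟩
  · rintro ⟨l', hl', hne', he⟩ x hx
    obtain ⟨m, hm, hz⟩ := hd.1 x
    by_cases hml : m = l
    · subst hml
      refine ⟨l', hl', hne', ?_⟩
      rw [← huniq m x hx hz, ← he]
      exact hμ l'
    · exact ⟨m, hm, hml, hz⟩

open Classical in
include hr in
lemma card_rooms (hd : IsDoor r d) :
    (Finset.univ.filter fun p : Finset T × Finset I => IsRoom r p ∧ Adj d p).card =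
      (d.2.filter fun l => Good r d l).card := by
  symm
  apply card_eq_of_rel _ _ (fun l p => Via r d l p)
  · intro l hl
    obtain ⟨hl, hg⟩ := Finset.mem_filter.1 hl
    obtain ⟨p, h1, h2, h3⟩ := exists_via hd hl hg
    exact ⟨p, by simp [h1, h2], h3⟩
  · intro p hp
    obtain ⟨-, h1, h2⟩ := Finset.mem_filter.1 hp
    obtain ⟨l, hl, hg, hv⟩ := via_of_adj hr h1 h2
    exact ⟨l, by simp [hl, hg], hv⟩
  · intro l _ p hp p' hp'
    exact via_unique hr (Finset.mem_filter.1 hp).2.1 (Finset.mem_filter.1 hp').2.1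
  · intro l hl l' hl' p _
    exact via_inj hd (Finset.mem_filter.1 hl).1 (Finset.mem_filter.1 hl').1

end door

/-- Every colour of `p.2` except possibly `i₀` occurs in `p.1`. -/
def NC (c : T → I) (i₀ : I) (p : Finset T × Finset I) : Prop := p.2.erase i₀ ⊆ p.1.image c

omit [Fintype T] [Fintype I] in
lemma NC_of_adj {c : T → I} {i₀ : I} {d p : Finset T × Finset I} (h : Adj d p)
    (hd : NC c i₀ d) : NC c i₀ p := by
  rcases h with ⟨x, hx, rfl⟩ | ⟨j, hj, rfl⟩
  · exact hd.trans (Finset.image_subset_image (Finset.erase_subset _ _))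
  · exact (Finset.erase_subset_erase _ (Finset.subset_insert _ _)).trans hd

open Classical in
lemma card_doors {r : I → T → ℕ} {c : T → I} {i₀ : I} {p : Finset T × Finset I}
    (hp : IsRoom r p) (hnc : NC c i₀ p) (hcol : p.1.image c ≠ p.2) :
    (Finset.univ.filter fun d : Finset T × Finset I =>
      (IsDoor r d ∧ NC c i₀ d) ∧ Adj d p).card = 2 := by
  obtain ⟨σ, C⟩ := p
  obtain ⟨hdom, hcard⟩ := hp
  simp only [NC] at hnc hcard hcol
  have hdoor : ∀ d, Adj d (σ, C) → IsDoor r d := by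
    rintro d (⟨x, hx, rfl⟩ | ⟨j, hj, rfl⟩)
    · exact ⟨dom_mono hdom (Finset.erase_subset _ _) (Finset.Subset.refl _), by
        simp only at hx ⊢
        rw [Finset.card_erase_of_mem hx, ← hcard]
        have := Finset.card_pos.2 ⟨x, hx⟩
        omega⟩
    · exact ⟨dom_mono hdom (Finset.Subset.refl _) (Finset.subset_insert _ _), by
        simp only at hj ⊢
        rw [Finset.card_insert_of_notMem hj, ← hcard]⟩
  have hle : (σ.image c).card ≤ C.card := hcard ▸ Finset.card_image_le
  have hi₀ : i₀ ∈ C := by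
    by_contra h
    rw [Finset.erase_eq_of_notMem h] at hnc
    exact hcol (Finset.eq_of_subset_of_card_le hnc hle).symm
  have hCe : (C.erase i₀).card + 1 = C.card := Finset.card_erase_add_one hi₀
  by_cases hE : σ.image c = C.erase i₀
  · rw [← card_collisions σ c (by rw [hE, hCe, hcard])]
    symm
    apply card_eq_of_rel _ _ (fun x d => d = (σ.erase x, C))
    · intro x hx
      obtain ⟨hx, x', hx', hne, hc⟩ := Finset.mem_filter.1 hx
      have ha : Adj (σ.erase x, C) (σ, C) := Or.inl ⟨x, hx, rfl⟩
      refine ⟨_, ?_, rfl⟩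
      simp only [Finset.mem_filter, Finset.mem_univ, true_and]
      refine ⟨⟨hdoor _ ha, ?_⟩, ha⟩
      intro m hm
      obtain ⟨y, hy, rfl⟩ := Finset.mem_image.1 (hnc hm)
      by_cases hyx : y = x
      · subst hyx
        exact Finset.mem_image.2 ⟨x', by simp [hne, hx'], hc⟩
      · exact Finset.mem_image_of_mem _ (by simp [hyx, hy])
    · intro d hd
      obtain ⟨-, ⟨h1, h2⟩, ha⟩ := Finset.mem_filter.1 hd
      simp only [NC] at h2
      rcases ha with ⟨x, hx, rfl⟩ | ⟨j, hj, rfl⟩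
      · refine ⟨x, Finset.mem_filter.2 ⟨hx, ?_⟩, rfl⟩
        have hcx : c x ∈ C.erase i₀ := hE ▸ Finset.mem_image_of_mem _ hx
        obtain ⟨y, hy, hyc⟩ := Finset.mem_image.1 (h2 hcx)
        simp only [Finset.mem_erase] at hy
        exact ⟨y, hy.2, hy.1, hyc⟩
      · exfalso
        simp only at hj h2
        have hji : j ≠ i₀ := fun h => hj (h ▸ hi₀)
        have : j ∈ σ.image c := h2 (by simp [hji])
        rw [hE] at this
        exact hj (Finset.mem_of_mem_erase this)
    · rintro x _ d _ d' _ rfl rfl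
      rfl
    · rintro x hx x' hx' d _ rfl h
      exact Finset.erase_injOn _ (Finset.mem_filter.1 hx).1 (Finset.mem_filter.1 hx').1
        (Prod.ext_iff.1 h).1
  · have hlt : (C.erase i₀).card < (σ.image c).card := Finset.card_lt_card
      (Finset.ssubset_iff_subset_ne.2 ⟨hnc, fun h => hE h.symm⟩)
    have hinj : Set.InjOn c σ := Finset.card_image_iff.1 (by omega)
    have hnsub : ¬ σ.image c ⊆ C := fun h => hcol (Finset.eq_of_subset_of_card_le h (by omega))
    obtain ⟨j, hj, hjC⟩ := Finset.not_subset.1 hnsub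
    obtain ⟨x, hx, rfl⟩ := Finset.mem_image.1 hj
    have hims : σ.image c = insert (c x) (C.erase i₀) := by
      symm
      apply Finset.eq_of_subset_of_card_le
      · intro m hm
        rcases Finset.mem_insert.1 hm with rfl | h
        · exact hj
        · exact hnc h
      · rw [Finset.card_insert_of_notMem (fun h => hjC (Finset.mem_of_mem_erase h))]
        omega
    have hset : (Finset.univ.filter fun d : Finset T × Finset I =>
        (IsDoor r d ∧ NC c i₀ d) ∧ Adj d (σ, C)) =
        {(σ.erase x, C), (σ, insert (c x) C)} := by
      ext d
      simp only [Finset.mem_filter, Finset.mem_univ, true_and, Finset.mem_insert,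
        Finset.mem_singleton]
      constructor
      · rintro ⟨⟨h1, h2⟩, ⟨y, hy, rfl⟩ | ⟨j, hj', rfl⟩⟩
        · left
          simp only [NC] at h2 hy
          have hyx : y = x := by
            by_contra hyx
            have hcy : c y ∈ σ.image c := Finset.mem_image_of_mem _ hy
            rw [hims] at hcy
            rcases Finset.mem_insert.1 hcy with h | h
            · exact hyx (hinj hy hx h)
            · obtain ⟨z, hz, hzc⟩ := Finset.mem_image.1 (h2 h)
              obtain ⟨hzy, hz⟩ := Finset.mem_erase.1 hz
              exact hzy (hinj hz hy hzc)
          rw [hyx]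
        · right
          simp only [NC] at h2 hj'
          have hji : j ≠ i₀ := fun h => hj' (h ▸ hi₀)
          have : j ∈ σ.image c := h2 (by simp [hji])
          rw [hims] at this
          rcases Finset.mem_insert.1 this with h | h
          · rw [h]
          · exact absurd (Finset.mem_of_mem_erase h) hj'
      · rintro (rfl | rfl)
        · have ha : Adj (σ.erase x, C) (σ, C) := Or.inl ⟨x, hx, rfl⟩
          refine ⟨⟨hdoor _ ha, ?_⟩, ha⟩
          intro m hm
          obtain ⟨y, hy, rfl⟩ := Finset.mem_image.1 (hnc hm)
          have hyx : y ≠ x := by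
            rintro rfl
            exact hjC (Finset.mem_of_mem_erase hm)
          exact Finset.mem_image_of_mem _ (by simp [hyx, hy])
        · have ha : Adj (σ, insert (c x) C) (σ, C) := Or.inr ⟨c x, hjC, rfl⟩
          refine ⟨⟨hdoor _ ha, ?_⟩, ha⟩
          intro m hm
          obtain ⟨hmi, hm⟩ := Finset.mem_erase.1 hm
          rcases Finset.mem_insert.1 hm with rfl | h
          · exact hj
          · exact hnc (Finset.mem_erase.2 ⟨hmi, h⟩)
    rw [hset, Finset.card_pair]
    intro h
    have := (Prod.ext_iff.1 h).2
    simp only at this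
    exact hjC (this ▸ Finset.mem_insert_self _ _)

/-- Scarf's lemma: some dominant pair is fully coloured. -/
theorem scarf [Nonempty T] [Nonempty I] {r : I → T → ℕ} (hr : ∀ i, Function.Injective (r i))
    (c : T → I) : ∃ p : Finset T × Finset I, Dominant r p ∧ p.1.image c = p.2 := by
  classical
  obtain ⟨i₀⟩ := ‹Nonempty I›
  by_contra hcon
  push Not at hcon
  set Rooms := Finset.univ.filter fun p : Finset T × Finset I => IsRoom r p ∧ NC c i₀ p
  set Doors := Finset.univ.filter fun p : Finset T × Finset I => IsDoor r p ∧ NC c i₀ p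
  have hcount := Finset.sum_card_bipartiteAbove_eq_sum_card_bipartiteBelow (s := Doors)
    (t := Rooms) (fun d p => Adj d p)
  have hR : ∀ p ∈ Rooms, (Doors.bipartiteBelow (fun d p => Adj d p) p).card = 2 := by
    intro p hp
    obtain ⟨-, hp, hnc⟩ := Finset.mem_filter.1 hp
    rw [← card_doors hp hnc (hcon p hp.1)]
    congr 1
    ext d
    simp [Finset.bipartiteBelow, Doors]
  have hD : ∀ d ∈ Doors, (Rooms.bipartiteAbove (fun d p => Adj d p) d).card =
      (d.2.filter fun l => Good r d l).card := by
    intro d hd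
    obtain ⟨-, hd, hnc⟩ := Finset.mem_filter.1 hd
    rw [← card_rooms hr hd]
    congr 1
    ext p
    simp only [Finset.bipartiteAbove, Rooms, Finset.mem_filter, Finset.mem_univ, true_and]
    exact ⟨fun h => ⟨h.1.1, h.2⟩, fun h => ⟨⟨h.1, NC_of_adj h.2 hnc⟩, h.2⟩⟩
  rw [Finset.sum_congr rfl hR, Finset.sum_congr rfl hD] at hcount
  have hd₀ : ((∅, {i₀}) : Finset T × Finset I) ∈ Doors := by
    refine Finset.mem_filter.2 ⟨Finset.mem_univ _, ⟨fun y => ⟨i₀, by simp, by simp⟩, by simp⟩, ?_⟩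
    simp [NC]
  rw [← Finset.add_sum_erase _ _ hd₀] at hcount
  have hD2 : ∀ d ∈ Doors.erase (∅, {i₀}), (d.2.filter fun l => Good r d l).card = 2 := by
    intro d hd
    obtain ⟨hne, hd⟩ := Finset.mem_erase.1 hd
    obtain ⟨-, hd, hnc⟩ := Finset.mem_filter.1 hd
    apply card_good hr hd
    by_contra hemp
    rw [Finset.not_nonempty_iff_eq_empty] at hemp
    apply hne
    have h1 : d.2.card = 1 := by rw [hd.2, hemp]; simp
    obtain ⟨j, hj⟩ := Finset.card_eq_one.1 h1
    have : j = i₀ := by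
      by_contra hji
      have : j ∈ d.1.image c := hnc (by simp [hj, hji])
      simp [hemp] at this
    exact Prod.ext hemp (by rw [hj, this])
  rw [Finset.sum_congr rfl hD2] at hcount
  have h1 : (({i₀} : Finset I).filter fun l => Good r ((∅, {i₀}) : Finset T × Finset I) l).card
      = 1 := by
    rw [Finset.filter_true_of_mem]
    · simp
    · intro l _ x hx
      simp at hx
  simp only [Finset.sum_const, smul_eq_mul] at hcount
  rw [h1] at hcount
  omega

end Scarf

namespace Scarf

/-- Integer points of the dilated simplex. -/
abbrev Grid (n N : ℕ) : Type := {a : Fin n → Fin (N + 1) // ∑ i, (a i : ℕ) = N}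

lemma exists_grid {n N : ℕ} (C : Finset (Fin n)) (hC : C.Nonempty) (m : Fin n → ℕ)
    (h : ∑ i ∈ C, m i ≤ N) : ∃ y : Grid n N, ∀ i ∈ C, m i ≤ (y.1 i : ℕ) := by
  classical
  obtain ⟨k, hk⟩ := hC
  let w : Fin n → ℕ := fun i => (if i ∈ C then m i else 0) +
    if i = k then N - ∑ i ∈ C, m i else 0
  have hw : ∑ i, w i = N := by
    simp only [w, Finset.sum_add_distrib, Finset.sum_ite_mem, Finset.univ_inter,
      Finset.sum_ite_eq', Finset.mem_univ, if_true]
    omega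
  have hwle : ∀ i, w i < N + 1 := fun i => by
    have := Finset.single_le_sum (f := w) (fun _ _ => Nat.zero_le _) (Finset.mem_univ i)
    omega
  refine ⟨⟨fun i => ⟨w i, hwle i⟩, by simpa using hw⟩, fun i hi => ?_⟩
  simp [w, hi]

lemma approx_fixed {n N : ℕ} (hn : 0 < n) (hN : 0 < N) (f : (Fin n → ℝ) → (Fin n → ℝ))
    (hf : Set.MapsTo f (stdSimplex ℝ (Fin n)) (stdSimplex ℝ (Fin n))) :
    ∃ a ∈ stdSimplex ℝ (Fin n), ∀ i, ∃ b ∈ stdSimplex ℝ (Fin n),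
      dist b a ≤ n / N ∧ a i - n / N ≤ f b i := by
  classical
  have hN' : (0 : ℝ) < N := by exact_mod_cast hN
  have : Nonempty (Fin n) := ⟨⟨0, hn⟩⟩
  have : Nonempty (Grid n N) := by
    obtain ⟨y, -⟩ := exists_grid (n := n) (N := N) {⟨0, hn⟩} (by simp) (fun _ => 0) (by simp)
    exact ⟨y⟩
  let e := Fintype.equivFin (Grid n N)
  set K := Fintype.card (Grid n N)
  let r : Fin n → Grid n N → ℕ := fun i a => (a.1 i : ℕ) * K + e a
  have hK : 0 < K := Fintype.card_pos
  have hr : ∀ i, Function.Injective (r i) := by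
    intro i a b hab
    have h1 : r i a % K = e a := by
      simp [r, Nat.mod_eq_of_lt (e a).2]
    have h2 : r i b % K = e b := by
      simp [r, Nat.mod_eq_of_lt (e b).2]
    apply e.injective
    apply Fin.ext
    rw [← h1, ← h2, hab]
  have hrm : ∀ i a b, r i a ≤ r i b → (a.1 i : ℕ) ≤ b.1 i := by
    intro i a b hab
    have h1 : (a.1 i : ℕ) * K + e a ≤ (b.1 i : ℕ) * K + e b := hab
    have h2 := (e b).2
    have : (a.1 i : ℕ) * K < ((b.1 i : ℕ) + 1) * K := by
      rw [add_mul]; omega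
    exact Nat.lt_succ_iff.1 (lt_of_mul_lt_mul_right this (Nat.zero_le _))
  let P : Grid n N → (Fin n → ℝ) := fun a i => (a.1 i : ℝ) / N
  have hP : ∀ a, P a ∈ stdSimplex ℝ (Fin n) := by
    intro a
    refine ⟨fun i => by positivity, ?_⟩
    simp only [P, ← Finset.sum_div]
    rw [div_eq_one_iff_eq hN'.ne']
    exact_mod_cast a.2
  have hcol : ∀ a : Grid n N, ∃ i, P a i ≤ f (P a) i := by
    intro a
    by_contra hcon
    push Not at hcon
    have := Finset.sum_lt_sum_of_nonempty (s := Finset.univ) Finset.univ_nonempty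
      (fun i _ => hcon i)
    rw [(hP a).2, (hf (hP a)).2] at this
    exact lt_irrefl _ this
  choose c hc using hcol
  obtain ⟨⟨σ, C⟩, hdom, him⟩ := scarf hr c
  simp only at him
  obtain ⟨a₀⟩ := ‹Nonempty (Grid n N)›
  have hCne : C.Nonempty := by
    obtain ⟨i, hi, -⟩ := hdom a₀
    exact ⟨i, hi⟩
  have hσ : σ.Nonempty := by
    rw [← him] at hCne
    exact Finset.image_nonempty.1 hCne
  have hmin : ∀ i, ∃ x ∈ σ, ∀ y ∈ σ, (x.1 i : ℕ) ≤ y.1 i := fun i =>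
    Finset.exists_min_image σ (fun x => (x.1 i : ℕ)) hσ
  choose μ hμσ hμ using hmin
  have hsum : N < ∑ i ∈ C, (((μ i).1 i : ℕ) + 1) := by
    by_contra hcon
    push Not at hcon
    obtain ⟨y, hy⟩ := exists_grid C hCne (fun i => ((μ i).1 i : ℕ) + 1) hcon
    obtain ⟨i, hi, hx⟩ := hdom y
    have h1 := hrm i _ _ (hx (μ i) (hμσ i))
    have h2 := hy i hi
    omega
  have hCn : C.card ≤ n := by simpa using Finset.card_le_univ C
  rw [Finset.sum_add_distrib] at hsum
  simp only [Finset.sum_const, smul_eq_mul, mul_one] at hsum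
  have hsplit : ∀ a : Grid n N, ∑ i ∈ C, (a.1 i : ℕ) + ∑ i ∈ Cᶜ, (a.1 i : ℕ) = N := by
    intro a
    rw [Finset.sum_add_sum_compl]
    exact a.2
  have hin : ∀ a ∈ σ, ∀ i ∈ C, (a.1 i : ℕ) < (μ i).1 i + n := by
    intro a ha i hi
    have h1 := Finset.add_sum_erase C (fun i => (a.1 i : ℕ)) hi
    have h2 := Finset.add_sum_erase C (fun i => ((μ i).1 i : ℕ)) hi
    have h3 : ∑ j ∈ C.erase i, ((μ j).1 j : ℕ) ≤ ∑ j ∈ C.erase i, (a.1 j : ℕ) :=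
      Finset.sum_le_sum fun j _ => hμ j a ha
    have := hsplit a
    omega
  have hout : ∀ a ∈ σ, ∀ i ∉ C, (a.1 i : ℕ) < n := by
    intro a ha i hi
    have h1 : (a.1 i : ℕ) ≤ ∑ i ∈ Cᶜ, (a.1 i : ℕ) :=
      Finset.single_le_sum (f := fun i => (a.1 i : ℕ)) (fun _ _ => Nat.zero_le _)
        (Finset.mem_compl.2 hi)
    have h3 : ∑ j ∈ C, ((μ j).1 j : ℕ) ≤ ∑ j ∈ C, (a.1 j : ℕ) :=
      Finset.sum_le_sum fun j _ => hμ j a ha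
    have := hsplit a
    omega
  have hclose : ∀ a ∈ σ, ∀ b ∈ σ, ∀ i, (a.1 i : ℕ) ≤ b.1 i + n := by
    intro a ha b hb i
    by_cases hi : i ∈ C
    · have h1 := hin a ha i hi
      have h2 := hμ i b hb
      omega
    · have := hout a ha i hi
      omega
  have hcloseR : ∀ a ∈ σ, ∀ b ∈ σ, ∀ i, P a i - n / N ≤ P b i := by
    intro a ha b hb i
    have h : ((a.1 i : ℕ) : ℝ) ≤ (b.1 i : ℕ) + n := by exact_mod_cast hclose a ha b hb i
    simp only [P]
    rw [← sub_div]
    gcongr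
    linarith
  obtain ⟨a, ha⟩ := hσ
  refine ⟨P a, hP a, fun i => ?_⟩
  by_cases hi : i ∈ C
  · rw [← him] at hi
    obtain ⟨b, hb, rfl⟩ := Finset.mem_image.1 hi
    refine ⟨P b, hP b, ?_, (hcloseR a ha b hb _).trans (hc b)⟩
    rw [dist_pi_le_iff (by positivity)]
    intro j
    rw [Real.dist_eq, abs_le]
    have h1 := hcloseR a ha b hb j
    have h2 := hcloseR b hb a ha j
    constructor <;> linarith
  · refine ⟨P a, hP a, by simp; positivity, ?_⟩
    have h : ((a.1 i : ℕ) : ℝ) ≤ n := by exact_mod_cast (hout a ha i hi).le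
    have h2 : P a i ≤ n / N := by
      simp only [P]
      gcongr
    linarith [(hf (hP a)).1 i]

/-- Brouwer's fixed point theorem for the standard simplex. -/
theorem brouwer {n : ℕ} (hn : 0 < n) (f : (Fin n → ℝ) → (Fin n → ℝ))
    (hc : ContinuousOn f (stdSimplex ℝ (Fin n)))
    (hf : Set.MapsTo f (stdSimplex ℝ (Fin n)) (stdSimplex ℝ (Fin n))) :
    ∃ x ∈ stdSimplex ℝ (Fin n), f x = x := by
  have h := fun N : ℕ => approx_fixed hn (Nat.succ_pos N) f hf
  choose a ha b hb hd hfb using h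
  obtain ⟨x, hx, φ, hφ, hlim⟩ := (isCompact_stdSimplex ℝ (Fin n)).tendsto_subseq ha
  refine ⟨x, hx, ?_⟩
  have h0 : Tendsto (fun N : ℕ => (n : ℝ) / (N.succ : ℕ)) atTop (𝓝 0) :=
    (tendsto_const_div_atTop_nhds_zero_nat (n : ℝ)).comp (tendsto_add_atTop_nat 1)
  have h0' := h0.comp hφ.tendsto_atTop
  have hbl : ∀ i, Tendsto (fun N => b (φ N) i) atTop (𝓝 x) := by
    intro i
    rw [tendsto_iff_dist_tendsto_zero] at hlim ⊢
    refine squeeze_zero (fun _ => dist_nonneg)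
      (g := fun N => (n : ℝ) / ((φ N).succ : ℕ) + dist (a (φ N)) x) ?_ ?_
    · intro N
      exact (dist_triangle _ (a (φ N)) _).trans (add_le_add (hd _ _) le_rfl)
    · simpa using h0'.add hlim
  have hle : ∀ i, x i ≤ f x i := by
    intro i
    have h1 : Tendsto (fun N => f (b (φ N) i)) atTop (𝓝 (f x)) :=
      (hc x hx).tendsto.comp (tendsto_nhdsWithin_iff.2 ⟨hbl i, Eventually.of_forall fun N => hb _ _⟩)
    have h2 := (tendsto_pi_nhds.1 h1) i
    have h3 := ((tendsto_pi_nhds.1 hlim) i).sub h0'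
    rw [sub_zero] at h3
    exact le_of_tendsto_of_tendsto' h3 h2 fun N => hfb _ i
  funext i
  have hs : ∑ i, x i = ∑ i, f x i := by rw [hx.2, (hf hx).2]
  exact ((Finset.sum_eq_sum_iff_of_le fun i _ => hle i).1 hs i (Finset.mem_univ i)).symm

end Scarf

/-- A nowhere vanishing field on a ball of the sum-zero hyperplane is somewhere a positive multiple
of the outward radial direction. -/
theorem exists_radial {n : ℕ} (hn : 0 < n) {R : ℝ} (hR : 0 < R) (F : (Fin n → ℝ) → (Fin n → ℝ))
    (hc : ContinuousOn F {t | ∑ i, t i = 0 ∧ ‖t‖ ≤ R})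
    (h0 : ∀ t, ∑ i, t i = 0 → ‖t‖ ≤ R → ∑ i, F t i = 0)
    (hne : ∀ t, ∑ i, t i = 0 → ‖t‖ ≤ R → F t ≠ 0) :
    ∃ t, ∑ i, t i = 0 ∧ ‖t‖ = R ∧ ∃ c : ℝ, 0 < c ∧ F t = c • t := by
  have hn' : (0 : ℝ) < n := by exact_mod_cast hn
  set K : Set (Fin n → ℝ) := {t | ∑ i, t i = 0 ∧ ‖t‖ ≤ R} with hK
  let S : ℝ := n * R
  have hS : 0 < S := by positivity
  let ρ : (Fin n → ℝ) → (Fin n → ℝ) := fun t => (R / max R ‖t‖) • t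
  let τ : (Fin n → ℝ) → (Fin n → ℝ) := fun x i => S * (x i - 1 / n)
  let G : (Fin n → ℝ) → (Fin n → ℝ) := fun x i =>
    1 / n + ((R / ‖F (ρ (τ x))‖) • F (ρ (τ x))) i / S
  have hmax : ∀ t : Fin n → ℝ, 0 < max R ‖t‖ := fun t => lt_max_of_lt_left hR
  have hρc : Continuous ρ := by
    have h1 : Continuous fun t : Fin n → ℝ => R / max R ‖t‖ := Continuous.div continuous_const (continuous_const.max continuous_norm) fun t => (hmax t).ne'
    exact h1.smul continuous_id
  have hτc : Continuous τ := by
    refine continuous_pi fun i => ?_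
    fun_prop
  have hτ0 : ∀ x ∈ stdSimplex ℝ (Fin n), ∑ i, τ x i = 0 := by
    intro x hx
    simp only [τ, ← Finset.mul_sum, Finset.sum_sub_distrib, hx.2]
    simp [hn'.ne']
  have hρK : ∀ x ∈ stdSimplex ℝ (Fin n), ρ (τ x) ∈ K := by
    intro x hx
    refine ⟨?_, ?_⟩
    · simp only [ρ, Pi.smul_apply, smul_eq_mul, ← Finset.mul_sum, hτ0 x hx, mul_zero]
    · simp only [ρ]
      rw [norm_smul, Real.norm_of_nonneg (div_nonneg hR.le (hmax _).le), div_mul_eq_mul_div,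
        div_le_iff₀ (hmax _)]
      exact mul_le_mul_of_nonneg_left (le_max_right _ _) hR.le
  have hFρ : ContinuousOn (fun x => F (ρ (τ x))) (stdSimplex ℝ (Fin n)) :=
    hc.comp (hρc.comp hτc).continuousOn hρK
  have hFne : ∀ x ∈ stdSimplex ℝ (Fin n), 0 < ‖F (ρ (τ x))‖ := fun x hx =>
    norm_pos_iff.2 (hne _ (hρK x hx).1 (hρK x hx).2)
  have hGc : ContinuousOn G (stdSimplex ℝ (Fin n)) := by
    refine continuousOn_pi.2 fun i => ?_
    refine continuousOn_const.add (ContinuousOn.div_const ?_ _)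
    have h1 : ContinuousOn (fun x => (R / ‖F (ρ (τ x))‖) • F (ρ (τ x))) (stdSimplex ℝ (Fin n)) :=
      (continuousOn_const.div hFρ.norm fun x hx => (hFne x hx).ne').smul hFρ
    exact continuousOn_pi.1 h1 i
  have hnorm : ∀ x ∈ stdSimplex ℝ (Fin n), ‖(R / ‖F (ρ (τ x))‖) • F (ρ (τ x))‖ = R := by
    intro x hx
    rw [norm_smul, Real.norm_of_nonneg (div_nonneg hR.le (norm_nonneg _)),
      div_mul_cancel₀ _ (hFne x hx).ne']
  have hGm : Set.MapsTo G (stdSimplex ℝ (Fin n)) (stdSimplex ℝ (Fin n)) := by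
    intro x hx
    refine ⟨fun i => ?_, ?_⟩
    · have h1 := norm_le_pi_norm ((R / ‖F (ρ (τ x))‖) • F (ρ (τ x))) i
      rw [hnorm x hx, Real.norm_eq_abs, abs_le] at h1
      have h2 : -(1 / n : ℝ) = -R / S := by
        simp only [S]; field_simp
      have h3 : -R / S ≤ ((R / ‖F (ρ (τ x))‖) • F (ρ (τ x))) i / S := by
        gcongr; exact h1.1
      simp only [G]
      linarith
    · simp only [G, Finset.sum_add_distrib, ← Finset.sum_div, Pi.smul_apply, smul_eq_mul,
        ← Finset.mul_sum, h0 _ (hρK x hx).1 (hρK x hx).2]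
      simp [hn'.ne']
  obtain ⟨x, hx, hfix⟩ := Scarf.brouwer hn G hGc hGm
  have ht : τ x = (R / ‖F (ρ (τ x))‖) • F (ρ (τ x)) := by
    funext i
    have h1 := congrFun hfix i
    simp only [G] at h1
    have h2 : τ x i = S * (x i - 1 / n) := rfl
    rw [h2, ← h1, add_sub_cancel_left, mul_div_cancel₀ _ hS.ne']
  have htn : ‖τ x‖ = R := by
    have := hnorm x hx
    rwa [← ht] at this
  have hρt : ρ (τ x) = τ x := by
    simp only [ρ, htn, max_self, div_self hR.ne', one_smul]
  have hF := hFne x hx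
  rw [hρt] at ht hF
  refine ⟨τ x, hτ0 x hx, htn, ‖F (τ x)‖ / R, by positivity, ?_⟩
  have h1 : (‖F (τ x)‖ / R) • τ x = (‖F (τ x)‖ / R) • ((R / ‖F (τ x)‖) • F (τ x)) :=
    congrArg _ ht
  rw [h1, smul_smul, div_mul_div_cancel₀ hR.ne', div_self hF.ne', one_smul]

section limit
variable {n : ℕ} {ι : Type*} [Lattice ι] [BoundedOrder ι]

open Classical in
/-- Families of nonnegative weights supported on chains cannot have almost vanishing barycentre
when the slowly growing part of their mass is normalised. -/
lemma no_small_barycentre {k : ι → ℕ} (hk : StrictMono k) (hkn : ∀ W, k W ≤ n)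
    {q : ι → Fin n → ℝ} {h : ι → ℝ} {Q B : ℝ} (hQ : ∀ W, ‖q W‖ ≤ Q) (hQ0 : 0 ≤ Q)
    (hfin : ∀ M : ℝ, {W | h W ≤ M}.Finite)
    (hind : ∀ S : Finset ι, IsChain (· ≤ ·) (S : Set ι) → ⊥ ∉ S → ⊤ ∉ S → ∀ c : ι → ℝ,
      (∀ W ∈ S, 0 ≤ c W) → ∑ W ∈ S, c W • q W = 0 → ∀ W ∈ S, c W = 0)
    (H : ∀ N : ℕ, ∃ S : Finset ι, IsChain (· ≤ ·) (S : Set ι) ∧ ⊥ ∉ S ∧ ⊤ ∉ S ∧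
      ∃ c : ι → ℝ, (∀ W, 0 ≤ c W) ∧ (∀ W, W ∉ S → c W = 0) ∧
        ∑ W ∈ (hfin 1).toFinset, c W = 1 ∧
        ∑ W ∈ S \ (hfin 1).toFinset, c W * h W ≤ B ∧
        ‖∑ W ∈ S, c W • q W‖ ≤ B / (N + 1 : ℝ)) : False := by
  choose S hS hbot htop c hc0 hcS hc1 hcB hcq using H
  have hmemfin : ∀ (M : ℝ) W, W ∈ (hfin M).toFinset ↔ h W ≤ M := fun M W => by simp
  have htail : ∀ N (M : ℝ), 1 ≤ M → M * ∑ W ∈ S N \ (hfin M).toFinset, c N W ≤ B := by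
    intro N M hM
    refine le_trans ?_ (hcB N)
    rw [Finset.mul_sum]
    refine le_trans (Finset.sum_le_sum (g := fun W => c N W * h W) ?_) ?_
    · intro W hW
      rw [Finset.mem_sdiff, hmemfin, not_le] at hW
      rw [mul_comm]
      exact mul_le_mul_of_nonneg_left hW.2.le (hc0 _ _)
    · refine Finset.sum_le_sum_of_subset_of_nonneg ?_ ?_
      · refine Finset.sdiff_subset_sdiff (Finset.Subset.refl _) ?_
        intro W hW
        rw [hmemfin] at hW ⊢
        exact hW.trans hM
      · intro W hW _
        rw [Finset.mem_sdiff, hmemfin, not_le] at hW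
        exact mul_nonneg (hc0 _ _) (by linarith)
  have hbd : ∀ N W, c N W ≤ 1 + B := by
    intro N W
    have hB : 0 ≤ B := by
      refine le_trans (mul_nonneg zero_le_one (Finset.sum_nonneg fun W _ => hc0 N W))
        (htail N 1 le_rfl)
    by_cases hW : W ∈ (hfin 1).toFinset
    · have := Finset.single_le_sum (f := c N) (fun W _ => hc0 N W) hW
      rw [hc1] at this
      linarith
    · by_cases hWS : W ∈ S N
      · have h1 := Finset.single_le_sum (f := c N) (fun W _ => hc0 N W)
          (Finset.mem_sdiff.2 ⟨hWS, hW⟩)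
        have := htail N 1 le_rfl
        linarith
      · rw [hcS N W hWS]; linarith
  have hlim : ∀ W, ∃ x, Tendsto (fun N => c N W) (hyperfilter ℕ : Filter ℕ) (𝓝 x) := by
    intro W
    obtain ⟨x, -, hx⟩ := (isCompact_Icc (a := (0 : ℝ)) (b := 1 + B)).ultrafilter_le_nhds
      ((hyperfilter ℕ).map fun N => c N W) (by
        rw [le_principal_iff]
        have h : ∀ᶠ N in (hyperfilter ℕ : Filter ℕ), c N W ∈ Set.Icc 0 (1 + B) :=
          Eventually.of_forall fun N => ⟨hc0 N W, hbd N W⟩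
        exact h)
    exact ⟨x, hx⟩
  choose e he using hlim
  have he0 : ∀ W, 0 ≤ e W := fun W => ge_of_tendsto' (he W) fun N => hc0 N W
  have hpos : ∀ W, 0 < e W → ∀ᶠ N in (hyperfilter ℕ : Filter ℕ), W ∈ S N := by
    intro W hW
    filter_upwards [(he W).eventually (lt_mem_nhds hW)] with N hN
    by_contra hcon
    rw [hcS N W hcon] at hN
    exact lt_irrefl _ hN
  have hchain : IsChain (· ≤ ·) {W | 0 < e W} := by
    intro W hW W' hW' hne
    obtain ⟨N, hN1, hN2⟩ := ((hpos W hW).and (hpos W' hW')).exists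
    exact hS N hN1 hN2 hne
  have hsupp : {W | 0 < e W}.Finite := by
    refine Set.Finite.of_finite_image (f := k) ?_ ?_
    · exact (Set.finite_Iic n).subset (by rintro _ ⟨W, -, rfl⟩; exact hkn W)
    · intro W hW W' hW' heq
      by_contra hne
      rcases hchain hW hW' hne with hl | hl
      · exact absurd heq (hk (lt_of_le_of_ne hl hne)).ne
      · exact absurd heq (hk (lt_of_le_of_ne hl (Ne.symm hne))).ne'
  set E := hsupp.toFinset
  have hEmem : ∀ W, W ∈ E ↔ 0 < e W := fun W => by simp [E]
  have hle : ∀ M : ℝ, 1 ≤ M → ‖∑ W ∈ (hfin M).toFinset, e W • q W‖ ≤ Q * (B / M) := by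
    intro M hM
    have h1 : Tendsto (fun N => ∑ W ∈ (hfin M).toFinset, c N W • q W)
        (hyperfilter ℕ : Filter ℕ) (𝓝 (∑ W ∈ (hfin M).toFinset, e W • q W)) :=
      tendsto_finsetSum _ fun W _ => (he W).smul_const _
    have h2 : Tendsto (fun N : ℕ => B / (N + 1 : ℝ) + Q * (B / M)) (hyperfilter ℕ : Filter ℕ)
        (𝓝 (0 + Q * (B / M))) := by
      refine Tendsto.add ?_ tendsto_const_nhds
      have h3 : Tendsto (fun N : ℕ => B / (N + 1 : ℝ)) atTop (𝓝 0) := by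
        have := (tendsto_const_div_atTop_nhds_zero_nat B).comp (tendsto_add_atTop_nat 1)
        refine this.congr fun N => ?_
        simp
      exact h3.mono_left Nat.hyperfilter_le_atTop
    rw [zero_add] at h2
    refine le_of_tendsto_of_tendsto' h1.norm h2 fun N => ?_
    have h4 : ∑ W ∈ (hfin M).toFinset, c N W • q W =
        ∑ W ∈ S N, c N W • q W - ∑ W ∈ S N \ (hfin M).toFinset, c N W • q W := by
      rw [eq_sub_iff_add_eq]
      have h5 : ∑ W ∈ (hfin M).toFinset, c N W • q W =
          ∑ W ∈ S N ∩ (hfin M).toFinset, c N W • q W := by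
        symm
        refine Finset.sum_subset Finset.inter_subset_right fun W hW hW' => ?_
        rw [hcS N W (fun hS => hW' (Finset.mem_inter.2 ⟨hS, hW⟩)), zero_smul]
      rw [h5, Finset.sum_inter_add_sum_sdiff]
    rw [h4]
    refine (norm_sub_le _ _).trans (add_le_add (hcq N) ?_)
    refine (norm_sum_le _ _).trans ?_
    refine le_trans (Finset.sum_le_sum (g := fun W => Q * c N W) fun W _ => ?_) ?_
    · rw [norm_smul, Real.norm_of_nonneg (hc0 _ _), mul_comm]
      exact mul_le_mul_of_nonneg_right (hQ W) (hc0 _ _)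
    · rw [← Finset.mul_sum]
      refine mul_le_mul_of_nonneg_left ?_ hQ0
      rw [le_div_iff₀ (by linarith), mul_comm]
      exact htail N M hM
  have hzero : ∑ W ∈ E, e W • q W = 0 := by
    obtain ⟨M₀, hM₀⟩ := (E.image h).exists_le
    have h1 : ∀ M : ℝ, max 1 M₀ ≤ M → ‖∑ W ∈ E, e W • q W‖ ≤ Q * (B / M) := by
      intro M hM
      have h2 : ∑ W ∈ E, e W • q W = ∑ W ∈ (hfin M).toFinset, e W • q W := by
        refine Finset.sum_subset ?_ ?_
        · intro W hW
          rw [hmemfin]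
          exact (hM₀ _ (Finset.mem_image_of_mem _ hW)).trans ((le_max_right _ _).trans hM)
        · intro W _ hW
          rw [hEmem, not_lt] at hW
          rw [le_antisymm hW (he0 W), zero_smul]
      rw [h2]
      exact hle M ((le_max_left _ _).trans hM)
    have h3 : Tendsto (fun M : ℝ => Q * (B / M)) atTop (𝓝 (Q * 0)) :=
      (tendsto_const_nhds.div_atTop tendsto_id).const_mul Q
    rw [mul_zero] at h3
    have := ge_of_tendsto h3 (eventually_atTop.2 ⟨_, h1⟩)
    exact norm_le_zero_iff.1 this
  have hall := hind E (by
      intro W hW W' hW' hne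
      exact hchain ((hEmem W).1 hW) ((hEmem W').1 hW') hne)
    (fun hb => by
      obtain ⟨N, hN⟩ := (hpos _ ((hEmem _).1 hb)).exists
      exact hbot N hN)
    (fun hb => by
      obtain ⟨N, hN⟩ := (hpos _ ((hEmem _).1 hb)).exists
      exact htop N hN) e (fun W _ => he0 W) hzero
  have hone : ∑ W ∈ (hfin 1).toFinset, e W = 1 := by
    refine tendsto_nhds_unique (tendsto_finsetSum _ fun W _ => he W) ?_
    simp only [hc1]
    exact tendsto_const_nhds
  have : ∑ W ∈ (hfin 1).toFinset, e W = 0 := by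
    refine Finset.sum_eq_zero fun W _ => ?_
    by_contra hne
    exact hne (hall W ((hEmem W).2 (lt_of_le_of_ne (he0 W) (Ne.symm hne))))
  linarith

lemma norm_sq_le_sum_sq (t : Fin n → ℝ) : ‖t‖ ^ 2 ≤ ∑ i, t i ^ 2 := by
  have h0 : 0 ≤ ∑ i, t i ^ 2 := Finset.sum_nonneg fun i _ => sq_nonneg _
  have h : ‖t‖ ≤ Real.sqrt (∑ i, t i ^ 2) := by
    rw [pi_norm_le_iff_of_nonneg (Real.sqrt_nonneg _)]
    intro i
    rw [Real.norm_eq_abs]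
    exact Real.abs_le_sqrt (Finset.single_le_sum (f := fun i => t i ^ 2)
      (fun i _ => sq_nonneg _) (Finset.mem_univ i))
  calc ‖t‖ ^ 2 ≤ Real.sqrt (∑ i, t i ^ 2) ^ 2 := by gcongr
    _ = _ := Real.sq_sqrt h0

open Classical in
/-- On large spheres no positive combination of the slopes of the negative functions of a chain
points outward. -/
lemma exists_radius {k : ι → ℕ} (hk : StrictMono k) (hkn : ∀ W, k W ≤ n)
    {q : ι → Fin n → ℝ} {h : ι → ℝ} {Q : ℝ} (hQ : ∀ W, ‖q W‖ ≤ Q) (hQ0 : 0 ≤ Q)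
    (hfin : ∀ M : ℝ, {W | h W ≤ M}.Finite)
    (hind : ∀ S : Finset ι, IsChain (· ≤ ·) (S : Set ι) → ⊥ ∉ S → ⊤ ∉ S → ∀ c : ι → ℝ,
      (∀ W ∈ S, 0 ≤ c W) → ∑ W ∈ S, c W • q W = 0 → ∀ W ∈ S, c W = 0)
    {f : ι → (Fin n → ℝ) → ℝ}
    (hlow : ∀ W t, ∑ i, t i = 0 → ∑ i, q W i * t i + h W ≤ f W t) :
    ∃ R : ℝ, 0 < R ∧ ∀ t, ∑ i, t i = 0 → ‖t‖ = R → ∀ S : Finset ι,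
      IsChain (· ≤ ·) (S : Set ι) → ⊥ ∉ S → ⊤ ∉ S → S.Nonempty → ∀ c : ι → ℝ,
      (∀ W ∈ S, 0 < c W) → ∀ a : ℝ, 0 < a → ∑ W ∈ S, c W • q W = a • t →
      ¬ ∀ W ∈ S, f W t < 0 := by
  by_contra hcon
  push Not at hcon
  obtain ⟨b, hb⟩ := ((hfin 0).image h).bddBelow
  set B : ℝ := max 0 (-b)
  have hB0 : 0 ≤ B := le_max_left _ _
  have hhB : ∀ W, -B ≤ h W := by
    intro W
    by_cases hW : h W ≤ 0
    · have h1 : b ≤ h W := hb ⟨W, hW, rfl⟩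
      have h2 : -b ≤ B := le_max_right _ _
      linarith
    · push Not at hW
      linarith
  refine no_small_barycentre (B := B) hk hkn hQ hQ0 hfin hind fun N => ?_
  obtain ⟨t, ht0, htR, S, hS, hbot, htop, hSne, c, hc, a, ha, hct, hf⟩ :=
    hcon (N + 1) (by positivity)
  set U := (hfin 1).toFinset with hU
  have hmemU : ∀ W, W ∈ U ↔ h W ≤ 1 := fun W => by simp [U]
  set s := ∑ W ∈ S ∩ U, c W with hs
  have hs0 : 0 ≤ s := Finset.sum_nonneg fun W hW => (hc W (Finset.mem_inter.1 hW).1).le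
  have hdot : ∑ W ∈ S, c W * ∑ i, q W i * t i = a * ∑ i, t i ^ 2 := by
    have h1 : ∀ i, ∑ W ∈ S, c W * q W i = a * t i := by
      intro i
      have := congrFun hct i
      simpa [Finset.sum_apply] using this
    calc ∑ W ∈ S, c W * ∑ i, q W i * t i = ∑ i, (∑ W ∈ S, c W * q W i) * t i := by
          simp only [Finset.mul_sum, Finset.sum_mul]
          rw [Finset.sum_comm]
          refine Finset.sum_congr rfl fun i _ => Finset.sum_congr rfl fun W _ => by ring
      _ = a * ∑ i, t i ^ 2 := by
          rw [Finset.mul_sum]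
          refine Finset.sum_congr rfl fun i _ => ?_
          rw [h1]; ring
  have hneg : ∑ W ∈ S, c W * ∑ i, q W i * t i + ∑ W ∈ S, c W * h W < 0 := by
    rw [← Finset.sum_add_distrib]
    refine Finset.sum_neg (fun W hW => ?_) hSne
    rw [← mul_add]
    exact mul_neg_of_pos_of_neg (hc W hW) ((hlow W t ht0).trans_lt (hf W hW))
  rw [hdot, ← Finset.sum_inter_add_sum_sdiff S U] at hneg
  have hin : -B * s ≤ ∑ W ∈ S ∩ U, c W * h W := by
    rw [hs, Finset.mul_sum]
    refine Finset.sum_le_sum fun W hW => ?_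
    rw [mul_comm]
    exact mul_le_mul_of_nonneg_left (hhB W) (hc W (Finset.mem_inter.1 hW).1).le
  have hout : 0 ≤ ∑ W ∈ S \ U, c W * h W := by
    refine Finset.sum_nonneg fun W hW => ?_
    rw [Finset.mem_sdiff, hmemU, not_le] at hW
    exact mul_nonneg (hc W hW.1).le (by linarith)
  have hsq : a * ((N : ℝ) + 1) ^ 2 ≤ a * ∑ i, t i ^ 2 := by
    rw [← htR]
    exact mul_le_mul_of_nonneg_left (norm_sq_le_sum_sq t) ha.le
  have hapos : 0 < a * ((N : ℝ) + 1) ^ 2 := by positivity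
  have hspos : 0 < s := by
    refine lt_of_le_of_ne hs0 fun h0 => ?_
    rw [← h0] at hin
    linarith
  refine ⟨S, hS, hbot, htop, fun W => if W ∈ S then c W / s else 0, ?_, ?_, ?_, ?_, ?_⟩
  · intro W
    dsimp only
    split_ifs with hW
    · exact div_nonneg (hc W hW).le hs0
    · exact le_rfl
  · intro W hW
    simp [hW]
  · rw [← Finset.sum_filter, Finset.filter_mem_eq_inter, ← Finset.sum_div, Finset.inter_comm,
      ← hs, div_self hspos.ne']
  · have h1 : ∑ W ∈ S \ U, (if W ∈ S then c W / s else 0) * h W =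
        (∑ W ∈ S \ U, c W * h W) / s := by
      rw [Finset.sum_div]
      refine Finset.sum_congr rfl fun W hW => ?_
      rw [if_pos (Finset.mem_sdiff.1 hW).1]
      ring
    rw [h1, div_le_iff₀ hspos]
    linarith
  · have h1 : ∑ W ∈ S, (if W ∈ S then c W / s else 0) • q W = (a / s) • t := by
      have : ∑ W ∈ S, (if W ∈ S then c W / s else 0) • q W = s⁻¹ • ∑ W ∈ S, c W • q W := by
        rw [Finset.smul_sum]
        refine Finset.sum_congr rfl fun W hW => ?_
        rw [if_pos hW, smul_smul, div_eq_inv_mul]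
      rw [this, hct, smul_smul, div_eq_inv_mul]
    rw [h1, norm_smul, htR, Real.norm_of_nonneg (by positivity), div_mul_eq_mul_div,
      div_le_div_iff₀ hspos (by positivity)]
    nlinarith

open Classical in
/-- A submodular family of functions with linear minorants whose slopes are positively independent
along chains has a common point of nonnegativity. -/
theorem exists_common_nonneg (hn : 0 < n) {k : ι → ℕ} (hk : StrictMono k) (hkn : ∀ W, k W ≤ n)
    (hkmod : ∀ W W', k (W ⊓ W') + k (W ⊔ W') = k W + k W')
    {q : ι → Fin n → ℝ} {h : ι → ℝ} {Q : ℝ} (hQ : ∀ W, ‖q W‖ ≤ Q) (hQ0 : 0 ≤ Q)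
    (hq0 : ∀ W, ∑ i, q W i = 0)
    (hfin : ∀ M : ℝ, {W | h W ≤ M}.Finite)
    (hind : ∀ S : Finset ι, IsChain (· ≤ ·) (S : Set ι) → ⊥ ∉ S → ⊤ ∉ S → ∀ c : ι → ℝ,
      (∀ W ∈ S, 0 ≤ c W) → ∑ W ∈ S, c W • q W = 0 → ∀ W ∈ S, c W = 0)
    {f : ι → (Fin n → ℝ) → ℝ} (hfc : ∀ W, Continuous (f W))
    (hlow : ∀ W t, ∑ i, t i = 0 → ∑ i, q W i * t i + h W ≤ f W t)
    (hsub : ∀ W W' t, ∑ i, t i = 0 → f (W ⊓ W') t + f (W ⊔ W') t ≤ f W t + f W' t)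
    (hbot : ∀ t, ∑ i, t i = 0 → 0 ≤ f ⊥ t) (htop : ∀ t, ∑ i, t i = 0 → 0 ≤ f ⊤ t) :
    ∃ t, ∑ i, t i = 0 ∧ ∀ W, 0 ≤ f W t := by
  by_contra hcon
  push Not at hcon
  obtain ⟨R, hR, hrad⟩ := exists_radius hk hkn hQ hQ0 hfin hind hlow
  set K : Set (Fin n → ℝ) := {t | ∑ i, t i = 0 ∧ ‖t‖ ≤ R} with hK
  have hKc : IsCompact K := by
    refine Metric.isCompact_of_isClosed_isBounded ?_ ?_
    · refine IsClosed.inter ?_ ?_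
      · exact isClosed_eq (by fun_prop) continuous_const
      · exact isClosed_le continuous_norm continuous_const
    · refine (Metric.isBounded_closedBall (x := (0 : Fin n → ℝ)) (r := R)).subset fun t ht => ?_
      simpa using ht.2
  set V := (hfin (n * (Q * R))).toFinset with hV
  have hVmem : ∀ t ∈ K, ∀ W, f W t ≤ 0 → W ∈ V := by
    intro t ht W hW
    simp only [hV, Set.Finite.mem_toFinset, Set.mem_ofPred_eq]
    have h1 := hlow W t ht.1
    have h2 : -(n * (Q * R)) ≤ ∑ i, q W i * t i := by
      have : ∑ _i : Fin n, -(Q * R) ≤ ∑ i, q W i * t i := by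
        refine Finset.sum_le_sum fun i _ => ?_
        have h3 : |q W i * t i| ≤ Q * R := by
          rw [abs_mul]
          exact mul_le_mul ((norm_le_pi_norm (q W) i).trans (hQ W))
            ((norm_le_pi_norm t i).trans ht.2) (abs_nonneg _) hQ0
        exact (abs_le.1 h3).1
      simpa using this
    linarith
  have h0K : (0 : Fin n → ℝ) ∈ K := by simp [hK, hR.le]
  have hVne : V.Nonempty := by
    obtain ⟨W, hW⟩ := hcon 0 (by simp)
    exact ⟨W, hVmem 0 h0K W hW.le⟩
  have hcinf : ∀ g : ι → (Fin n → ℝ) → ℝ, (∀ W, Continuous (g W)) →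
      Continuous fun t => V.inf' hVne fun W => g W t := by
    intro g hg
    exact Continuous.finset_inf'_apply hVne fun W _ => hg W
  obtain ⟨t₁, ht₁, hmax⟩ := hKc.exists_isMaxOn ⟨0, h0K⟩ (hcinf f hfc).continuousOn
  set δ : ℝ := -(V.inf' hVne fun W => f W t₁) with hδ
  have hδ0 : 0 < δ := by
    obtain ⟨W, hW⟩ := hcon t₁ ht₁.1
    have := Finset.inf'_le (fun W => f W t₁) (hVmem t₁ ht₁ W hW.le)
    linarith
  have hδK : ∀ t ∈ K, ∃ W ∈ V, f W t ≤ -δ := by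
    intro t ht
    obtain ⟨W, hW, he⟩ := Finset.exists_mem_eq_inf' hVne fun W => f W t
    refine ⟨W, hW, ?_⟩
    rw [← he, hδ, neg_neg]
    exact hmax ht
  set ε : ℝ := δ / (4 * (n ^ 2 + 1)) with hε
  have hε0 : 0 < ε := by positivity
  have hεδ : ε * (n ^ 2 + 1) = δ / 4 := by
    rw [hε]; field_simp
  have hεle : ε ≤ δ / 4 := by
    rw [← hεδ]
    nlinarith [sq_nonneg (n : ℝ)]
  let g : ι → ℝ := fun W => k W * (n - k W)
  have hkn' : ∀ W, (k W : ℝ) ≤ n := fun W => by exact_mod_cast hkn W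
  have hk0 : ∀ W, (0 : ℝ) ≤ k W := fun W => Nat.cast_nonneg _
  have hg0 : ∀ W, 0 ≤ g W := fun W => mul_nonneg (hk0 W) (by linarith [hkn' W])
  have hgn : ∀ W, g W ≤ n ^ 2 := fun W => by
    simp only [g]
    nlinarith [hk0 W, hkn' W]
  let F₁ : ι → (Fin n → ℝ) → ℝ := fun W t => f W t + ε * g W
  have hF₁f : ∀ W t, f W t ≤ F₁ W t := fun W t => by
    have := mul_nonneg hε0.le (hg0 W)
    simp only [F₁]
    linarith
  let m : (Fin n → ℝ) → ℝ := fun t => V.inf' hVne fun W => F₁ W t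
  have hF₁c : ∀ W, Continuous (F₁ W) := fun W => (hfc W).add continuous_const
  have hmc : Continuous m := hcinf F₁ hF₁c
  have hmle : ∀ t ∈ K, m t ≤ -(3 / 4) * δ := by
    intro t ht
    obtain ⟨W, hW, hf⟩ := hδK t ht
    have h1 : m t ≤ F₁ W t := Finset.inf'_le (fun W => F₁ W t) hW
    have h2 : ε * g W ≤ ε * (n ^ 2 + 1) :=
      mul_le_mul_of_nonneg_left (by linarith [hgn W]) hε0.le
    simp only [F₁] at h1
    linarith
  have hmin : ∀ t ∈ K, ∀ W, F₁ W t < m t → False := by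
    intro t ht W hW
    have h1 := hmle t ht
    have hWV := hVmem t ht W (by linarith [hF₁f W t])
    have h2 : m t ≤ F₁ W t := Finset.inf'_le (fun W => F₁ W t) hWV
    linarith
  let φ : ι → (Fin n → ℝ) → ℝ := fun W t => max 0 (m t + ε - F₁ W t)
  have hφc : ∀ W, Continuous (φ W) := fun W =>
    continuous_const.max ((hmc.add continuous_const).sub (hF₁c W))
  have hφpos : ∀ W t, 0 < φ W t ↔ F₁ W t < m t + ε := by
    intro W t
    simp only [φ, lt_max_iff, lt_irrefl, false_or, sub_pos]
  have hφneg : ∀ t ∈ K, ∀ W, 0 < φ W t → f W t < 0 := by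
    intro t ht W hW
    rw [hφpos] at hW
    linarith [hmle t ht, hF₁f W t]
  let S : (Fin n → ℝ) → Finset ι := fun t => V.filter fun W => 0 < φ W t
  have hSmem : ∀ t W, W ∈ S t → 0 < φ W t := fun t W hW => (Finset.mem_filter.1 hW).2
  have hSchain : ∀ t ∈ K, IsChain (· ≤ ·) (S t : Set ι) := by
    intro t ht W hW W' hW' _
    by_contra hnc
    push Not at hnc
    have h1 := (hφpos _ _).1 (hSmem t W hW)
    have h2 := (hφpos _ _).1 (hSmem t W' hW')
    have hl : k (W ⊓ W') < k W := hk (inf_lt_left.2 hnc.1)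
    have hl' : k (W ⊓ W') < k W' := hk (inf_lt_right.2 hnc.2)
    have hm : (k (W ⊓ W') : ℝ) + k (W ⊔ W') = k W + k W' := by exact_mod_cast hkmod W W'
    have hlr : (k (W ⊓ W') : ℝ) + 1 ≤ k W := by exact_mod_cast hl
    have hlr' : (k (W ⊓ W') : ℝ) + 1 ≤ k W' := by exact_mod_cast hl'
    have hgg : g (W ⊓ W') + g (W ⊔ W') + 2 ≤ g W + g W' := by
      have h3 : (k (W ⊔ W') : ℝ) = k W + k W' - k (W ⊓ W') := by linarith
      simp only [g]
      rw [h3]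
      nlinarith [mul_nonneg (sub_nonneg.2 hlr) (sub_nonneg.2 hlr')]
    have hss := hsub W W' t ht.1
    have hsum : F₁ (W ⊓ W') t + F₁ (W ⊔ W') t < m t + m t := by
      have := mul_le_mul_of_nonneg_left hgg hε0.le
      simp only [F₁] at h1 h2 ⊢
      linarith
    by_cases hlt : F₁ (W ⊓ W') t < m t
    · exact hmin t ht _ hlt
    · exact hmin t ht (W ⊔ W') (by linarith)
  have hSbot : ∀ t ∈ K, ⊥ ∉ S t := fun t ht hb =>
    absurd (hφneg t ht _ (hSmem t _ hb)) (not_lt.2 (hbot t ht.1))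
  have hStop : ∀ t ∈ K, ⊤ ∉ S t := fun t ht hb =>
    absurd (hφneg t ht _ (hSmem t _ hb)) (not_lt.2 (htop t ht.1))
  have hSne : ∀ t, (S t).Nonempty := by
    intro t
    obtain ⟨W, hW, he⟩ := Finset.exists_mem_eq_inf' hVne fun W => F₁ W t
    refine ⟨W, Finset.mem_filter.2 ⟨hW, (hφpos W t).2 ?_⟩⟩
    have : m t = F₁ W t := he
    linarith
  let F : (Fin n → ℝ) → (Fin n → ℝ) := fun t => ∑ W ∈ V, φ W t • q W
  have hFS : ∀ t, F t = ∑ W ∈ S t, φ W t • q W := by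
    intro t
    symm
    refine Finset.sum_subset (Finset.filter_subset _ _) fun W hW hWS => ?_
    have h1 : ¬ 0 < φ W t := fun h => hWS (Finset.mem_filter.2 ⟨hW, h⟩)
    have h2 : 0 ≤ φ W t := le_max_left _ _
    rw [le_antisymm (not_lt.1 h1) h2, zero_smul]
  have hFc : Continuous F := continuous_finsetSum _ fun W _ => (hφc W).smul continuous_const
  have hF0 : ∀ t, ∑ i, F t i = 0 := by
    intro t
    simp only [F, Finset.sum_apply, Pi.smul_apply, smul_eq_mul]
    rw [Finset.sum_comm]
    refine Finset.sum_eq_zero fun W _ => ?_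
    rw [← Finset.mul_sum, hq0, mul_zero]
  obtain ⟨t, ht0, htR, a, ha, hFt⟩ := exists_radial hn hR F hFc.continuousOn
    (fun t _ _ => hF0 t) (fun t ht0 htR hF => by
      have htK : t ∈ K := ⟨ht0, htR⟩
      rw [hFS] at hF
      obtain ⟨W, hW⟩ := hSne t
      exact (hSmem t W hW).ne' (hind (S t) (hSchain t htK) (hSbot t htK) (hStop t htK)
        (fun W => φ W t) (fun W hW => (hSmem t W hW).le) hF W hW))
  have htK : t ∈ K := ⟨ht0, htR.le⟩
  exact hrad t ht0 htR (S t) (hSchain t htK) (hSbot t htK) (hStop t htK) (hSne t)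
    (fun W => φ W t) (fun W hW => hSmem t W hW) a ha (by rw [← hFS, hFt])
    fun W hW => hφneg t htK W (hSmem t W hW)

end limit

/-- The Gram determinant of the rows of a matrix. -/
def gdet {α ν R : Type*} [Fintype α] [DecidableEq α] [Fintype ν] [CommRing R]
    (V : Matrix α ν R) : R := (V * Vᵀ).det

section gram
variable {α β γ ν ν' : Type*} [Fintype α] [DecidableEq α] [Fintype β] [DecidableEq β]
  [Fintype γ] [DecidableEq γ] [Fintype ν] [Fintype ν'] {R : Type*} [CommRing R]

lemma det_mul_eq_sum (A : Matrix α ν R) (B : Matrix ν α R) :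
    (A * B).det = ∑ σ : α → ν, (∏ i, A i (σ i)) * (B.submatrix σ id).det := by
  classical
  have h1 : (A * B).det = Matrix.detRowAlternating fun i => ∑ j, A i j • B j := by
    change Matrix.detRowAlternating (A * B) = _
    congr 1
    funext i k
    simp [Matrix.mul_apply, Finset.sum_apply]
  rw [h1]
  have h2 := (Matrix.detRowAlternating (R := R) (n := α)).toMultilinearMap.map_sum
    (fun i j => A i j • B j)
  simp only [AlternatingMap.coe_multilinearMap] at h2
  rw [h2]
  refine Finset.sum_congr rfl fun σ _ => ?_
  have h3 := (Matrix.detRowAlternating (R := R) (n := α)).toMultilinearMap.map_smul_univ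
    (fun i => A i (σ i)) (fun i => B (σ i))
  simp only [AlternatingMap.coe_multilinearMap] at h3
  rw [h3, smul_eq_mul]
  rfl

/-- The Cauchy–Binet formula, with the minors indexed by functions. -/
lemma factorial_mul_gdet (V : Matrix α ν R) :
    ((Fintype.card α).factorial : R) * gdet V = ∑ σ : α → ν, (V.submatrix id σ).det ^ 2 := by
  have h0 : gdet V = ∑ σ : α → ν, (∏ i, V i (σ i)) * (V.submatrix id σ).det := by
    rw [gdet, det_mul_eq_sum]
    refine Finset.sum_congr rfl fun σ _ => ?_
    rw [← Matrix.det_transpose (V.submatrix id σ)]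
    rfl
  have h1 : ∀ π : Equiv.Perm α, gdet V = ∑ σ : α → ν,
      (((Equiv.Perm.sign π : ℤ) : R) * ∏ i, V i (σ (π i))) * (V.submatrix id σ).det := by
    intro π
    rw [h0, ← (Equiv.arrowCongr π.symm (Equiv.refl ν)).sum_comp]
    refine Finset.sum_congr rfl fun σ _ => ?_
    have : (V.submatrix id (σ ∘ π)).det =
        ((Equiv.Perm.sign π : ℤ) : R) * (V.submatrix id σ).det := by
      have := Matrix.det_permute' π (V.submatrix id σ)
      rw [← this]
      rfl
    have h2 : (Equiv.arrowCongr π.symm (Equiv.refl ν)) σ = σ ∘ π := by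
      funext i
      simp [Equiv.arrowCongr]
    rw [h2, this]
    simp only [Function.comp]
    ring
  have h2 : ∑ _π : Equiv.Perm α, gdet V = ((Fintype.card α).factorial : R) * gdet V := by
    rw [Finset.sum_const, Finset.card_univ, Fintype.card_perm, nsmul_eq_mul]
  rw [← h2, Finset.sum_congr rfl fun π _ => h1 π, Finset.sum_comm]
  refine Finset.sum_congr rfl fun σ _ => ?_
  rw [← Finset.sum_mul, sq]
  congr 1
  rw [← Matrix.det_transpose, Matrix.det_apply']
  rfl

lemma gdet_mul_left (U : Matrix α α R) (V : Matrix α ν R) : gdet (U * V) = U.det ^ 2 * gdet V := by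
  rw [gdet, Matrix.transpose_mul, Matrix.mul_assoc, ← Matrix.mul_assoc V, Matrix.det_mul,
    Matrix.det_mul, Matrix.det_transpose, gdet]
  ring

lemma gdet_submatrix (e : β ≃ α) (V : Matrix α ν R) : gdet (V.submatrix e id) = gdet V := by
  rw [gdet, gdet, ← Matrix.det_submatrix_equiv_self e (V * Vᵀ)]
  rfl

lemma gdet_square (V : Matrix α α R) : gdet V = V.det ^ 2 := by
  rw [gdet, Matrix.det_mul, Matrix.det_transpose, sq]

lemma gdet_map {S : Type*} [CommRing S] (f : R →+* S) (V : Matrix α ν R) :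
    gdet (V.map f) = f (gdet V) := by
  rw [gdet, gdet, RingHom.map_det]
  congr 1
  ext i j
  simp [Matrix.mul_apply]

variable [LinearOrder R] [IsStrictOrderedRing R]

lemma gdet_eq_zero_iff (V : Matrix α ν R) : gdet V = 0 ↔ ∃ v, v ≠ 0 ∧ v ᵥ* V = 0 := by
  rw [gdet, ← Matrix.exists_vecMul_eq_zero_iff]
  refine exists_congr fun v => and_congr_right fun _ => ⟨fun h => ?_, fun h => ?_⟩
  · rw [← Matrix.vecMul_vecMul] at h
    have h1 : (v ᵥ* V) ⬝ᵥ (v ᵥ* V) = 0 := by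
      have : ((v ᵥ* V) ᵥ* Vᵀ) ⬝ᵥ v = 0 := by rw [h, zero_dotProduct]
      rw [Matrix.vecMul_transpose, dotProduct_comm, Matrix.dotProduct_mulVec] at this
      exact this
    exact dotProduct_self_eq_zero.1 h1
  · rw [← Matrix.vecMul_vecMul, h, Matrix.zero_vecMul]

end gram

section real
variable {α β γ ν ν' : Type*} [Fintype α] [DecidableEq α] [Fintype β] [DecidableEq β]
  [Fintype γ] [DecidableEq γ] [Fintype ν] [Fintype ν']

lemma gdet_nonneg (V : Matrix α ν ℝ) : 0 ≤ gdet V := by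
  have h := factorial_mul_gdet V
  have h1 : (0 : ℝ) ≤ ((Fintype.card α).factorial : ℝ) * gdet V :=
    h ▸ Finset.sum_nonneg fun σ _ => sq_nonneg _
  exact nonneg_of_mul_nonneg_right h1 (by positivity)

lemma gdet_le_fromCols (V : Matrix α ν ℝ) (V' : Matrix α ν' ℝ) :
    gdet V ≤ gdet (Matrix.fromCols V V') := by
  have hc : (0 : ℝ) < ((Fintype.card α).factorial : ℝ) := by positivity
  refine le_of_mul_le_mul_left ?_ hc
  rw [factorial_mul_gdet, factorial_mul_gdet]
  let e : (α → ν) ↪ (α → ν ⊕ ν') :=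
    ⟨fun σ i => Sum.inl (σ i), fun σ τ h => funext fun i => Sum.inl_injective (congrFun h i)⟩
  calc ∑ σ : α → ν, (V.submatrix id σ).det ^ 2
      = ∑ σ ∈ Finset.univ.map e, ((Matrix.fromCols V V').submatrix id σ).det ^ 2 := by
        rw [Finset.sum_map]
        rfl
    _ ≤ _ := Finset.sum_le_sum_of_subset_of_nonneg (Finset.subset_univ _)
        fun _ _ _ => sq_nonneg _

/-- The component of the rows of `B` orthogonal to the rows of `A`. -/
def orthPart (A : Matrix α ν ℝ) (B : Matrix β ν ℝ) : Matrix β ν ℝ :=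
  B - B * Aᵀ * (A * Aᵀ)⁻¹ * A

omit [Fintype β] [DecidableEq β] in
lemma orthPart_mul (A : Matrix α ν ℝ) (B : Matrix β ν ℝ) (hA : gdet A ≠ 0) :
    orthPart A B * Aᵀ = 0 := by
  have h : IsUnit (A * Aᵀ).det := isUnit_iff_ne_zero.2 hA
  rw [orthPart, Matrix.sub_mul, Matrix.mul_assoc _ A, Matrix.mul_assoc _ _ (A * Aᵀ),
    Matrix.nonsing_inv_mul _ h, Matrix.mul_one, sub_self]

lemma gdet_fromRows (A : Matrix α ν ℝ) (B : Matrix β ν ℝ) (hA : gdet A ≠ 0) :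
    gdet (Matrix.fromRows A B) = gdet A * gdet (orthPart A B) := by
  have h : IsUnit (A * Aᵀ).det := isUnit_iff_ne_zero.2 hA
  have hinv : Invertible (A * Aᵀ) := Matrix.invertibleOfIsUnitDet _ h
  rw [gdet, Matrix.transpose_fromRows, Matrix.fromRows_mul_fromCols, Matrix.det_fromBlocks₁₁,
    gdet]
  congr 1
  rw [gdet]
  congr 1
  have h1 : orthPart A B * (orthPart A B)ᵀ = orthPart A B * Bᵀ := by
    conv_lhs => rw [orthPart.eq_def A B]
    rw [Matrix.transpose_sub, Matrix.mul_sub]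
    rw [Matrix.transpose_mul, ← Matrix.mul_assoc]
    have := orthPart_mul A B hA
    rw [orthPart] at this
    rw [this, Matrix.zero_mul, sub_zero, orthPart]
  rw [h1, orthPart, Matrix.sub_mul, Matrix.invOf_eq_nonsing_inv]
  simp only [Matrix.mul_assoc]

lemma gdet_fromRows_le (A : Matrix α ν ℝ) (B : Matrix β ν ℝ) (hA : gdet A ≠ 0) :
    gdet (Matrix.fromRows A B) ≤ gdet A * gdet B := by
  rw [gdet_fromRows A B hA]
  refine mul_le_mul_of_nonneg_left ?_ (gdet_nonneg A)
  set D := B * Aᵀ * (A * Aᵀ)⁻¹ * A with hD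
  have h1 : gdet B = gdet (Matrix.fromCols (orthPart A B) D) := by
    rw [gdet, gdet, Matrix.transpose_fromCols, Matrix.fromCols_mul_fromRows]
    congr 1
    have hB : B = orthPart A B + D := by rw [orthPart, sub_add_cancel]
    have h2 : orthPart A B * Dᵀ = 0 := by
      rw [hD, Matrix.transpose_mul, ← Matrix.mul_assoc, orthPart_mul A B hA, Matrix.zero_mul]
    have h3 : D * (orthPart A B)ᵀ = 0 := by
      rw [← Matrix.transpose_transpose (D * _), Matrix.transpose_mul, Matrix.transpose_transpose,
        h2, Matrix.transpose_zero]
    conv_lhs => rw [hB]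
    rw [Matrix.transpose_add, Matrix.add_mul, Matrix.mul_add, Matrix.mul_add, h2, h3, add_zero,
      zero_add]
  rw [h1]
  exact gdet_le_fromCols _ _

/-- The Koteljanskii inequality for Gram determinants. -/
lemma gdet_submodular (A : Matrix α ν ℝ) (B : Matrix β ν ℝ) (C : Matrix γ ν ℝ)
    (hA : gdet A ≠ 0) (hAB : gdet (Matrix.fromRows A B) ≠ 0) :
    gdet (Matrix.fromRows A (Matrix.fromRows B C)) * gdet A ≤
      gdet (Matrix.fromRows A B) * gdet (Matrix.fromRows A C) := by
  have h1 : orthPart A (Matrix.fromRows B C) =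
      Matrix.fromRows (orthPart A B) (orthPart A C) := by
    simp only [orthPart, Matrix.fromRows_mul]
    ext i j
    rcases i with i | i <;> rfl
  rw [gdet_fromRows A B hA] at hAB
  rw [gdet_fromRows _ _ hA, gdet_fromRows _ _ hA, gdet_fromRows _ _ hA, h1]
  have h2 := gdet_fromRows_le (orthPart A B) (orthPart A C) (right_ne_zero_of_mul hAB)
  have h3 := mul_le_mul_of_nonneg_left h2 (sq_nonneg (gdet A))
  nlinarith

end real

section latDet
variable {α β γ ν : Type*} [Fintype α] [DecidableEq α] [Fintype β] [DecidableEq β]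
  [Fintype γ] [DecidableEq γ] [Fintype ν] [DecidableEq ν]

/-- The squared covolume of the lattice spanned by the rows of `w * M`. -/
def latDet (M : Matrix ν ν ℝ) (w : Matrix α ν ℤ) : ℝ := gdet (w.map (Int.cast : ℤ → ℝ) * M)

omit [DecidableEq ν] in
lemma latDet_reindex (M : Matrix ν ν ℝ) (e : β ≃ α) (w : Matrix α ν ℤ) :
    latDet M (w.submatrix e id) = latDet M w := by
  rw [latDet, latDet, ← gdet_submatrix e]
  rfl

lemma latDet_pos {M : Matrix ν ν ℝ} (hM : M.det ≠ 0) {w : Matrix α ν ℤ}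
    (hw : LinearIndependent ℤ w) : 0 < latDet M w := by
  refine lt_of_le_of_ne (gdet_nonneg _) fun h => ?_
  obtain ⟨v, hv, hv0⟩ := (gdet_eq_zero_iff _).1 h.symm
  rw [← Matrix.vecMul_vecMul] at hv0
  have h1 : v ᵥ* w.map (Int.cast : ℤ → ℝ) = 0 := by
    by_contra hne
    exact hM (Matrix.exists_vecMul_eq_zero_iff.1 ⟨_, hne, hv0⟩)
  have h2 : gdet (w.map (Int.castRingHom ℝ)) = 0 := (gdet_eq_zero_iff _).2 ⟨v, hv, h1⟩
  rw [gdet_map] at h2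
  have h3 : gdet w = 0 := by simpa using h2
  obtain ⟨c, hc, hc0⟩ := (gdet_eq_zero_iff _).1 h3
  refine hc (funext fun i => ?_)
  refine (Fintype.linearIndependent_iff.1 hw) c ?_ i
  rw [← hc0]
  ext j
  simp [Matrix.vecMul, dotProduct, Finset.sum_apply]

omit [DecidableEq ν] in
lemma latDet_le_of_mem_span {M : Matrix ν ν ℝ} {w : Matrix β ν ℤ} {w' : Matrix α ν ℤ}
    (hcard : Fintype.card α = Fintype.card β)
    (hmem : ∀ i, w' i ∈ Submodule.span ℤ (Set.range w)) (hne : latDet M w' ≠ 0) :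
    latDet M w ≤ latDet M w' := by
  let e : α ≃ β := Fintype.equivOfCardEq hcard
  rw [← latDet_reindex M e w]
  have h1 : ∀ i, ∃ c : β → ℤ, ∑ j, c j • w j = w' i := fun i =>
    (Submodule.mem_span_range_iff_exists_fun ℤ).1 (hmem i)
  choose c hc using h1
  let U : Matrix α α ℤ := Matrix.of fun i j => c i (e j)
  have hU : w' = U * w.submatrix e id := by
    ext i k
    rw [← hc i, Matrix.mul_apply, ← e.sum_comp]
    simp [U, Finset.sum_apply]
  have h2 : latDet M w' = ((U.det : ℤ) : ℝ) ^ 2 * latDet M (w.submatrix e id) := by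
    have hm : (U * w.submatrix e id).map (Int.cast : ℤ → ℝ) =
        U.map (Int.cast : ℤ → ℝ) * (w.submatrix e id).map (Int.cast : ℤ → ℝ) :=
      Matrix.map_mul (f := Int.castRingHom ℝ)
    rw [latDet, hU, hm, Matrix.mul_assoc, gdet_mul_left, latDet]
    congr 2
    exact ((Int.castRingHom ℝ).map_det U).symm
  have h3 : U.det ≠ 0 := by
    rintro h
    rw [h] at h2
    simp [h2] at hne
  have h4 : (1 : ℝ) ≤ ((U.det : ℤ) : ℝ) ^ 2 := by
    have : (1 : ℤ) ≤ U.det ^ 2 := by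
      have : 0 < U.det ^ 2 := by positivity
      omega
    exact_mod_cast this
  rw [h2]
  exact le_mul_of_one_le_left (gdet_nonneg _) h4

lemma latDet_eq_of_span_eq {M : Matrix ν ν ℝ} (hM : M.det ≠ 0) {w : Matrix β ν ℤ}
    {w' : Matrix α ν ℤ} (hcard : Fintype.card α = Fintype.card β)
    (hw : LinearIndependent ℤ w) (hw' : LinearIndependent ℤ w')
    (h : Submodule.span ℤ (Set.range w) = Submodule.span ℤ (Set.range w')) :
    latDet M w = latDet M w' :=
  le_antisymm
    (latDet_le_of_mem_span hcard
      (fun i => h ▸ Submodule.subset_span (Set.mem_range_self i)) (latDet_pos hM hw').ne')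
    (latDet_le_of_mem_span hcard.symm
      (fun i => h.symm ▸ Submodule.subset_span (Set.mem_range_self i)) (latDet_pos hM hw).ne')

lemma latDet_submodular {M : Matrix ν ν ℝ} (hM : M.det ≠ 0) {A : Matrix α ν ℤ}
    {B : Matrix β ν ℤ} {C : Matrix γ ν ℤ} (hA : LinearIndependent ℤ A)
    (hAB : LinearIndependent ℤ (Matrix.fromRows A B)) :
    latDet M (Matrix.fromRows A (Matrix.fromRows B C)) * latDet M A ≤
      latDet M (Matrix.fromRows A B) * latDet M (Matrix.fromRows A C) := by
  have h := gdet_submodular (A.map (Int.cast : ℤ → ℝ) * M) (B.map (Int.cast : ℤ → ℝ) * M)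
    (C.map (Int.cast : ℤ → ℝ) * M)
  have hm2 : (Matrix.fromRows A (Matrix.fromRows B C)).map (Int.cast : ℤ → ℝ) * M =
        Matrix.fromRows (A.map (Int.cast : ℤ → ℝ) * M) (Matrix.fromRows
          (B.map (Int.cast : ℤ → ℝ) * M) (C.map (Int.cast : ℤ → ℝ) * M)) := by
    rw [← Matrix.fromRows_mul, ← Matrix.fromRows_mul]
    congr 1
    ext i j
    rcases i with i | i | i <;> rfl
  have hm3 : (Matrix.fromRows A B).map (Int.cast : ℤ → ℝ) * M =
        Matrix.fromRows (A.map (Int.cast : ℤ → ℝ) * M) (B.map (Int.cast : ℤ → ℝ) * M) := by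
    rw [← Matrix.fromRows_mul]
    congr 1
    ext i j
    rcases i with i | i <;> rfl
  have hm4 : (Matrix.fromRows A C).map (Int.cast : ℤ → ℝ) * M =
        Matrix.fromRows (A.map (Int.cast : ℤ → ℝ) * M) (C.map (Int.cast : ℤ → ℝ) * M) := by
    rw [← Matrix.fromRows_mul]
    congr 1
    ext i j
    rcases i with i | i <;> rfl
  have hAB' := (latDet_pos hM hAB).ne'
  simp only [latDet] at hAB' ⊢
  rw [hm2, hm3, hm4]
  rw [hm3] at hAB'
  exact h (latDet_pos hM hA).ne' hAB'

end latDet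

section intPts
variable {n : ℕ}

/-- The integral points of a rational subspace. -/
def intPts (W : Submodule ℚ (Fin n → ℚ)) : Submodule ℤ (Fin n → ℤ) :=
  (W.restrictScalars ℤ).comap ((Int.castAddHom ℚ).compLeft (Fin n)).toIntLinearMap

lemma mem_intPts {W : Submodule ℚ (Fin n → ℚ)} {x : Fin n → ℤ} :
    x ∈ intPts W ↔ (fun i => (x i : ℚ)) ∈ W := Iff.rfl

lemma linearIndependent_ratCast {α : Type*} {w : α → Fin n → ℤ} :
    LinearIndependent ℚ (fun i j => (w i j : ℚ)) ↔ LinearIndependent ℤ w := by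
  rw [← LinearIndependent.iff_fractionRing ℤ ℚ]
  refine LinearMap.linearIndependent_iff (v := w)
    ((Int.castAddHom ℚ).compLeft (Fin n)).toIntLinearMap ?_
  rw [LinearMap.ker_eq_bot]
  intro x y h
  funext i
  exact Int.cast_injective (α := ℚ) (congrFun h i)

lemma exists_int_smul_ratVec (x : Fin n → ℚ) :
    ∃ (N : ℤ) (y : Fin n → ℤ), N ≠ 0 ∧ (fun i => (y i : ℚ)) = (N : ℚ) • x := by
  obtain ⟨b, hb⟩ := IsLocalization.exist_integer_multiples_of_finset (nonZeroDivisors ℤ)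
    (Finset.univ.image x)
  have h : ∀ i, ∃ z : ℤ, (z : ℚ) = (b : ℤ) • x i := fun i => by
    obtain ⟨z, hz⟩ := hb (x i) (Finset.mem_image_of_mem _ (Finset.mem_univ i))
    exact ⟨z, by simpa using hz⟩
  choose y hy using h
  refine ⟨b, y, nonZeroDivisors.coe_ne_zero b, funext fun i => ?_⟩
  rw [hy]
  simp

lemma span_ratCast_eq {α : Type*} {W : Submodule ℚ (Fin n → ℚ)} {b : α → Fin n → ℤ}
    (hb : Submodule.span ℤ (Set.range b) = intPts W) :
    Submodule.span ℚ (Set.range fun i j => (b i j : ℚ)) = W := by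
  apply le_antisymm
  · rw [Submodule.span_le]
    rintro _ ⟨i, rfl⟩
    have : b i ∈ intPts W := hb ▸ Submodule.subset_span (Set.mem_range_self i)
    exact mem_intPts.1 this
  · intro x hx
    obtain ⟨N, y, hN, hy⟩ := exists_int_smul_ratVec x
    have h1 : y ∈ Submodule.span ℤ (Set.range b) := by
      rw [hb, mem_intPts, hy]
      exact W.smul_mem _ hx
    have h2 : ∀ z ∈ Submodule.span ℤ (Set.range b), (fun j => (z j : ℚ)) ∈
        Submodule.span ℚ (Set.range fun i j => (b i j : ℚ)) := by
      have : Submodule.span ℤ (Set.range b) ≤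
          intPts (Submodule.span ℚ (Set.range fun i j => (b i j : ℚ))) := by
        rw [Submodule.span_le]
        rintro _ ⟨i, rfl⟩
        exact mem_intPts.2 (Submodule.subset_span ⟨i, rfl⟩)
      exact fun z hz => mem_intPts.1 (this hz)
    have h3 := h2 y h1
    rw [hy] at h3
    have hN' : (N : ℚ) ≠ 0 := by exact_mod_cast hN
    exact (Submodule.smul_mem_iff _ hN').1 h3

lemma finrank_eq_card_of_intBasis {α : Type*} [Fintype α] {W : Submodule ℚ (Fin n → ℚ)}
    {b : α → Fin n → ℤ} (hi : LinearIndependent ℤ b)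
    (hb : Submodule.span ℤ (Set.range b) = intPts W) :
    Module.finrank ℚ W = Fintype.card α := by
  rw [← span_ratCast_eq hb]
  exact finrank_span_eq_card (linearIndependent_ratCast.2 hi)

lemma exists_basis_family {E : Type*} [AddCommGroup E] [Module.Free ℤ E] [Module.Finite ℤ E]
    (P : Submodule ℤ E) :
    ∃ (k : ℕ) (b : Fin k → E), LinearIndependent ℤ b ∧ Submodule.span ℤ (Set.range b) = P := by
  let b := Module.finBasis ℤ P
  refine ⟨_, fun i => (b i : E), ?_, ?_⟩
  · exact b.linearIndependent.map' P.subtype P.ker_subtype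
  · have h : (Set.range fun i => (b i : E)) = P.subtype '' Set.range b := by
      rw [← Set.range_comp]
      rfl
    rw [h, Submodule.span_image, b.span_eq, Submodule.map_top, Submodule.range_subtype]

lemma exists_intBasis (W : Submodule ℚ (Fin n → ℚ)) :
    ∃ b : Matrix (Fin (Module.finrank ℚ W)) (Fin n) ℤ, LinearIndependent ℤ b ∧
      Submodule.span ℤ (Set.range b) = intPts W := by
  obtain ⟨k, b, h1, h2⟩ := exists_basis_family (intPts W)
  have h3 := finrank_eq_card_of_intBasis h1 h2
  rw [Fintype.card_fin] at h3
  rw [h3]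
  exact ⟨b, h1, h2⟩

/-- A basis of the integral points of a rational subspace. -/
def intBasis (W : Submodule ℚ (Fin n → ℚ)) : Matrix (Fin (Module.finrank ℚ W)) (Fin n) ℤ :=
  (exists_intBasis W).choose

lemma linearIndependent_intBasis (W : Submodule ℚ (Fin n → ℚ)) :
    LinearIndependent ℤ (intBasis W) := (exists_intBasis W).choose_spec.1

lemma span_intBasis (W : Submodule ℚ (Fin n → ℚ)) :
    Submodule.span ℤ (Set.range (intBasis W)) = intPts W := (exists_intBasis W).choose_spec.2

lemma exists_complement_basis {E : Type*} [AddCommGroup E] [Module.Free ℤ E] [Module.Finite ℤ E]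
    {N P : Submodule ℤ E} (hNP : N ≤ P) (hsat : ∀ (k : ℤ) (x : E), k ≠ 0 → k • x ∈ N → x ∈ N)
    {α : Type*} {A : α → E} (hA : LinearIndependent ℤ A)
    (hAN : Submodule.span ℤ (Set.range A) = N) :
    ∃ (k : ℕ) (B : Fin k → E), LinearIndependent ℤ (Sum.elim A B) ∧
      Submodule.span ℤ (Set.range (Sum.elim A B)) = P := by
  let N' : Submodule ℤ P := N.comap P.subtype
  have htf : Module.IsTorsionFree ℤ (P ⧸ N') := by
    refine Module.IsTorsionFree.of_smul_eq_zero fun k x hx => ?_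
    obtain ⟨x, rfl⟩ := N'.mkQ_surjective x
    rw [or_iff_not_imp_left]
    intro hk
    rw [← map_smul, Submodule.mkQ_apply, Submodule.Quotient.mk_eq_zero] at hx
    rw [Submodule.mkQ_apply, Submodule.Quotient.mk_eq_zero]
    exact hsat k x hk hx
  let a : Module.Basis α ℤ N' := ((Module.Basis.span hA).map (LinearEquiv.ofEq _ _ hAN)).map
    (Submodule.comapSubtypeEquivOfLe hNP).symm
  have ha : ∀ i, ((a i : P) : E) = A i := by
    intro i
    simp only [a, Module.Basis.map_apply, Module.Basis.span_apply]
    rfl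
  let s := Module.Basis.sumQuot a (Module.finBasis ℤ (P ⧸ N'))
  have hs : Sum.elim A (fun i => (s (Sum.inr i) : E)) = P.subtype ∘ s := by
    funext i
    rcases i with i | i
    · simp only [Sum.elim_inl, Function.comp, s, Module.Basis.sumQuot_inl]
      exact (ha i).symm
    · rfl
  refine ⟨_, fun i => (s (Sum.inr i) : E), ?_, ?_⟩
  · rw [hs]
    exact s.linearIndependent.map' P.subtype P.ker_subtype
  · rw [hs, Set.range_comp, Submodule.span_image, s.span_eq, Submodule.map_top,
      Submodule.range_subtype]

lemma intPts_saturated (W : Submodule ℚ (Fin n → ℚ)) (k : ℤ) (x : Fin n → ℤ) (hk : k ≠ 0)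
    (hx : k • x ∈ intPts W) : x ∈ intPts W := by
  rw [mem_intPts] at hx ⊢
  have h : (fun i => (((k • x) i : ℤ) : ℚ)) = (k : ℚ) • fun i => (x i : ℚ) := by
    funext i
    simp
  rw [h] at hx
  exact (Submodule.smul_mem_iff _ (by exact_mod_cast hk)).1 hx

lemma intPts_mono {W W' : Submodule ℚ (Fin n → ℚ)} (h : W ≤ W') : intPts W ≤ intPts W' :=
  fun _ hx => h hx

/-- The squared covolume, in the lattice spanned by the rows of `M`, of the primitive sublattice
attached to a rational subspace. -/
def subDet (M : Matrix (Fin n) (Fin n) ℝ) (W : Submodule ℚ (Fin n → ℚ)) : ℝ :=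
  latDet M (intBasis W)

lemma subDet_pos {M : Matrix (Fin n) (Fin n) ℝ} (hM : M.det ≠ 0)
    (W : Submodule ℚ (Fin n → ℚ)) : 0 < subDet M W :=
  latDet_pos hM (linearIndependent_intBasis W)

lemma latDet_eq_subDet {M : Matrix (Fin n) (Fin n) ℝ} (hM : M.det ≠ 0) {α : Type*} [Fintype α]
    [DecidableEq α] {W : Submodule ℚ (Fin n → ℚ)} {b : Matrix α (Fin n) ℤ}
    (hi : LinearIndependent ℤ b) (hb : Submodule.span ℤ (Set.range b) = intPts W) :
    latDet M b = subDet M W := by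
  refine latDet_eq_of_span_eq hM ?_ (linearIndependent_intBasis W) hi ?_ |>.symm
  · rw [Fintype.card_fin, finrank_eq_card_of_intBasis hi hb]
  · rw [hb, span_intBasis]

lemma subDet_le_latDet {M : Matrix (Fin n) (Fin n) ℝ} (hM : M.det ≠ 0) {α : Type*} [Fintype α]
    [DecidableEq α] {W : Submodule ℚ (Fin n → ℚ)} {w : Matrix α (Fin n) ℤ}
    (hi : LinearIndependent ℤ w) (hw : ∀ i, w i ∈ intPts W)
    (hcard : Fintype.card α = Module.finrank ℚ W) : subDet M W ≤ latDet M w :=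
  latDet_le_of_mem_span (by rw [hcard, Fintype.card_fin])
    (fun i => by rw [span_intBasis]; exact hw i) (latDet_pos hM hi).ne'

lemma exists_subDet_le_latDet {M : Matrix (Fin n) (Fin n) ℝ} (hM : M.det ≠ 0) {α : Type*}
    [Fintype α] [DecidableEq α] {w : Matrix α (Fin n) ℤ} (hi : LinearIndependent ℤ w) :
    ∃ W, subDet M W ≤ latDet M w := by
  refine ⟨Submodule.span ℚ (Set.range fun i j => (w i j : ℚ)),
    subDet_le_latDet hM hi (fun i => mem_intPts.2 (Submodule.subset_span ⟨i, rfl⟩)) ?_⟩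
  exact (finrank_span_eq_card (linearIndependent_ratCast.2 hi)).symm

lemma subDet_submodular {M : Matrix (Fin n) (Fin n) ℝ} (hM : M.det ≠ 0)
    (W W' : Submodule ℚ (Fin n → ℚ)) :
    subDet M (W ⊓ W') * subDet M (W ⊔ W') ≤ subDet M W * subDet M W' := by
  obtain ⟨k, B, hB, hBW⟩ := exists_complement_basis (intPts_mono (inf_le_left : W ⊓ W' ≤ W))
    (intPts_saturated _) (linearIndependent_intBasis (W ⊓ W')) (span_intBasis _)
  obtain ⟨l, C, hC, hCW⟩ := exists_complement_basis (intPts_mono (inf_le_right : W ⊓ W' ≤ W'))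
    (intPts_saturated _) (linearIndependent_intBasis (W ⊓ W')) (span_intBasis _)
  have hABC : LinearIndependent ℤ
      (Matrix.fromRows (intBasis (W ⊓ W')) (Matrix.fromRows (Matrix.of B) (Matrix.of C))) := by
    obtain ⟨-, hC1, hdis⟩ := linearIndependent_sum.1 hC
    change LinearIndependent ℤ C at hC1
    change Disjoint (Submodule.span ℤ (Set.range (intBasis (W ⊓ W'))))
      (Submodule.span ℤ (Set.range C)) at hdis
    have h1 : LinearIndependent ℤ (Sum.elim (Sum.elim (intBasis (W ⊓ W')) B) C) := by
      refine hB.sum_type hC1 (Submodule.disjoint_def.2 fun x hx hx' => ?_)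
      refine Submodule.disjoint_def.1 hdis x ?_ hx'
      rw [span_intBasis]
      rw [hBW] at hx
      have h2 : x ∈ intPts W' := by
        rw [← hCW]
        refine Submodule.span_mono ?_ hx'
        rintro _ ⟨i, rfl⟩
        exact ⟨Sum.inr i, rfl⟩
      exact ⟨hx, h2⟩
    have h3 := h1.comp _ (Equiv.sumAssoc _ _ _).symm.injective
    have h4 : (Sum.elim (Sum.elim (intBasis (W ⊓ W')) B) C) ∘ (Equiv.sumAssoc _ _ _).symm =
        Matrix.fromRows (intBasis (W ⊓ W')) (Matrix.fromRows (Matrix.of B) (Matrix.of C)) := by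
      funext i
      rcases i with i | i | i <;> rfl
    exact h4 ▸ h3
  have h1 := latDet_submodular (M := M) (A := intBasis (W ⊓ W')) (B := Matrix.of B)
    (C := Matrix.of C) hM (linearIndependent_intBasis _) hB
  have h2 : latDet M (Matrix.fromRows (intBasis (W ⊓ W')) (Matrix.of B)) = subDet M W :=
    latDet_eq_subDet hM hB hBW
  have h3 : latDet M (Matrix.fromRows (intBasis (W ⊓ W')) (Matrix.of C)) = subDet M W' :=
    latDet_eq_subDet hM hC hCW
  rw [h2, h3, mul_comm] at h1
  refine le_trans (mul_le_mul_of_nonneg_left ?_ (subDet_pos hM _).le) h1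
  have hmemB : ∀ i, B i ∈ intPts W := fun i =>
    hBW ▸ Submodule.subset_span ⟨Sum.inr i, rfl⟩
  have hmemC : ∀ i, C i ∈ intPts W' := fun i =>
    hCW ▸ Submodule.subset_span ⟨Sum.inr i, rfl⟩
  have hmemA : ∀ i, intBasis (W ⊓ W') i ∈ intPts (W ⊓ W') := fun i =>
    span_intBasis (W ⊓ W') ▸ Submodule.subset_span ⟨i, rfl⟩
  refine subDet_le_latDet hM hABC ?_ ?_
  · rintro (i | i | i)
    · exact intPts_mono (inf_le_left.trans le_sup_left) (hmemA i)
    · exact intPts_mono le_sup_left (hmemB i)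
    · exact intPts_mono le_sup_right (hmemC i)
  · have e1 := finrank_eq_card_of_intBasis hB hBW
    have e2 := finrank_eq_card_of_intBasis hC hCW
    have e3 := Submodule.finrank_sup_add_finrank_inf_eq W W'
    simp only [Fintype.card_sum, Fintype.card_fin] at e1 e2 ⊢
    omega

lemma subDet_bot (M : Matrix (Fin n) (Fin n) ℝ) :
    subDet M (⊥ : Submodule ℚ (Fin n → ℚ)) = 1 := by
  have : IsEmpty (Fin (Module.finrank ℚ (⊥ : Submodule ℚ (Fin n → ℚ)))) := by
    rw [finrank_bot]
    infer_instance
  exact Matrix.det_isEmpty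

lemma subDet_top {M : Matrix (Fin n) (Fin n) ℝ} (hM : M.det ≠ 0) :
    subDet M (⊤ : Submodule ℚ (Fin n → ℚ)) = M.det ^ 2 := by
  have h1 : (⇑(Pi.basisFun ℤ (Fin n)) : Fin n → Fin n → ℤ) = (1 : Matrix (Fin n) (Fin n) ℤ) := by
    funext i j
    simp [Matrix.one_apply, Pi.single_apply, eq_comm]
  rw [← latDet_eq_subDet hM (b := (1 : Matrix (Fin n) (Fin n) ℤ)) (W := ⊤), latDet, gdet_square]
  · simp
  · rw [← h1]
    exact (Pi.basisFun ℤ (Fin n)).linearIndependent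
  · rw [← h1, (Pi.basisFun ℤ (Fin n)).span_eq]
    exact (eq_top_iff.2 fun _ _ => trivial).symm

end intPts

section weights
variable {n : ℕ} {α : Type*} [Fintype α]

/-- The multiplicities of the values of a map. -/
def mult (σ : α → Fin n) (j : Fin n) : ℝ := ∑ i, if σ i = j then 1 else 0

lemma sum_mult_mul (σ : α → Fin n) (t : Fin n → ℝ) :
    ∑ j, mult σ j * t j = ∑ i, t (σ i) := by
  simp only [mult, Finset.sum_mul]
  rw [Finset.sum_comm]
  simp

lemma sum_mult (σ : α → Fin n) : ∑ j, mult σ j = Fintype.card α := by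
  have := sum_mult_mul σ (fun _ => 1)
  simpa using this

lemma mult_nonneg (σ : α → Fin n) (j : Fin n) : 0 ≤ mult σ j :=
  Finset.sum_nonneg fun i _ => by split_ifs <;> norm_num

lemma mult_le (σ : α → Fin n) (j : Fin n) : mult σ j ≤ Fintype.card α := by
  rw [← sum_mult σ]
  exact Finset.single_le_sum (fun j _ => mult_nonneg σ j) (Finset.mem_univ j)

variable [DecidableEq α]

/-- The squared minor of `V` with columns given by `σ`, weighted by `θ`. -/
def minorWt (V : Matrix α (Fin n) ℝ) (θ : Finset (Fin n) → ℝ) (σ : α → Fin n) : ℝ :=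
  (V.submatrix id σ).det ^ 2 * θ (Finset.univ.image σ)

/-- The weighted sum of the squared minors. -/
def totalWt (V : Matrix α (Fin n) ℝ) (θ : Finset (Fin n) → ℝ) : ℝ := ∑ σ, minorWt V θ σ

/-- The weighted sum of the multiplicity vectors. -/
def rawSlope (V : Matrix α (Fin n) ℝ) (θ : Finset (Fin n) → ℝ) (j : Fin n) : ℝ :=
  ∑ σ, minorWt V θ σ * mult σ j

/-- The weighted average of the multiplicity vectors, projected to the sum-zero hyperplane. -/
def meanSlope (V : Matrix α (Fin n) ℝ) (θ : Finset (Fin n) → ℝ) (j : Fin n) : ℝ :=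
  rawSlope V θ j / totalWt V θ - Fintype.card α / n

variable {V : Matrix α (Fin n) ℝ} {θ : Finset (Fin n) → ℝ}

lemma minorWt_nonneg (hθ : ∀ I, 1 ≤ θ I ∧ θ I ≤ 2) (σ : α → Fin n) : 0 ≤ minorWt V θ σ :=
  mul_nonneg (sq_nonneg _) (zero_le_one.trans (hθ _).1)

lemma factorial_mul_gdet_le_totalWt (hθ : ∀ I, 1 ≤ θ I ∧ θ I ≤ 2) :
    ((Fintype.card α).factorial : ℝ) * gdet V ≤ totalWt V θ := by
  rw [factorial_mul_gdet]
  exact Finset.sum_le_sum fun σ _ => le_mul_of_one_le_right (sq_nonneg _) (hθ _).1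

lemma totalWt_pos (hθ : ∀ I, 1 ≤ θ I ∧ θ I ≤ 2) (hV : 0 < gdet V) : 0 < totalWt V θ :=
  lt_of_lt_of_le (by positivity) (factorial_mul_gdet_le_totalWt hθ)

lemma sum_meanSlope (hn : 0 < n) (hθ : ∀ I, 1 ≤ θ I ∧ θ I ≤ 2) (hV : 0 < gdet V) :
    ∑ j, meanSlope V θ j = 0 := by
  have hZ := (totalWt_pos hθ hV).ne'
  have h1 : ∑ j, rawSlope V θ j = totalWt V θ * Fintype.card α := by
    simp only [rawSlope]
    rw [Finset.sum_comm, totalWt, Finset.sum_mul]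
    exact Finset.sum_congr rfl fun σ _ => by rw [← Finset.mul_sum, sum_mult]
  simp only [meanSlope, Finset.sum_sub_distrib, Finset.sum_const, Finset.card_univ, Fintype.card_fin,
    nsmul_eq_mul, ← Finset.sum_div]
  rw [h1]
  have : (n : ℝ) ≠ 0 := by positivity
  field_simp
  ring

lemma norm_meanSlope_le (hn : 0 < n) (hα : Fintype.card α ≤ n) (hθ : ∀ I, 1 ≤ θ I ∧ θ I ≤ 2)
    (hV : 0 < gdet V) : ‖meanSlope V θ‖ ≤ n + 1 := by
  have hZ := totalWt_pos hθ hV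
  have hn' : (0 : ℝ) < n := by positivity
  have hα' : (Fintype.card α : ℝ) ≤ n := by exact_mod_cast hα
  rw [pi_norm_le_iff_of_nonneg (by positivity)]
  intro j
  have h1 : 0 ≤ rawSlope V θ j / totalWt V θ :=
    div_nonneg (Finset.sum_nonneg fun σ _ => mul_nonneg (minorWt_nonneg hθ σ) (mult_nonneg σ j))
      hZ.le
  have h2 : rawSlope V θ j / totalWt V θ ≤ n := by
    rw [div_le_iff₀ hZ, rawSlope, totalWt, Finset.mul_sum]
    refine Finset.sum_le_sum fun σ _ => ?_
    rw [mul_comm]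
    exact mul_le_mul_of_nonneg_right ((mult_le σ j).trans hα') (minorWt_nonneg hθ σ)
  have h3 : (0 : ℝ) ≤ Fintype.card α / n := by positivity
  have h4 : (Fintype.card α : ℝ) / n ≤ 1 := (div_le_one hn').2 hα'
  rw [Real.norm_eq_abs, abs_le, meanSlope]
  constructor <;> linarith

lemma factorial_mul_gdet_diagonal (V : Matrix α (Fin n) ℝ) (t : Fin n → ℝ) :
    ((Fintype.card α).factorial : ℝ) * gdet (V * Matrix.diagonal fun j => Real.exp (t j)) =
      ∑ σ : α → Fin n, (V.submatrix id σ).det ^ 2 * Real.exp (2 * ∑ i, t (σ i)) := by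
  rw [factorial_mul_gdet]
  refine Finset.sum_congr rfl fun σ _ => ?_
  have h1 : (V * Matrix.diagonal fun j => Real.exp (t j)).submatrix id σ =
      (V.submatrix id σ) * Matrix.diagonal fun i => Real.exp (t (σ i)) := by
    ext i j
    simp [Matrix.mul_diagonal]
  rw [h1, Matrix.det_mul, Matrix.det_diagonal, mul_pow, ← Real.exp_sum, two_mul, Real.exp_add, sq,
    sq]

lemma log_gdet_lower (hθ : ∀ I, 1 ≤ θ I ∧ θ I ≤ 2) (hV : 0 < gdet V)
    (t : Fin n → ℝ) (ht : ∑ j, t j = 0) :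
    ∑ j, meanSlope V θ j * t j + (Real.log (gdet V) / 2 - Real.log 2 / 2) ≤
      Real.log (gdet (V * Matrix.diagonal fun j => Real.exp (t j))) / 2 := by
  have hZ := totalWt_pos hθ hV
  set Z := totalWt V θ with hZdef
  set s : ℝ := ∑ j, meanSlope V θ j * t j with hs
  have hs1 : s = ∑ σ, (minorWt V θ σ / Z) * ∑ i, t (σ i) := by
    have : ∀ j, meanSlope V θ j * t j =
        ∑ σ, (minorWt V θ σ / Z) * (mult σ j * t j) - (Fintype.card α / n : ℝ) * t j := by
      intro j
      rw [meanSlope, sub_mul, rawSlope, Finset.sum_div, Finset.sum_mul]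
      congr 1
      exact Finset.sum_congr rfl fun σ _ => by ring
    rw [hs, Finset.sum_congr rfl fun j _ => this j, Finset.sum_sub_distrib, ← Finset.mul_sum, ht,
      mul_zero, sub_zero, Finset.sum_comm]
    exact Finset.sum_congr rfl fun σ _ => by rw [← Finset.mul_sum, sum_mult_mul]
  have hjensen : Real.exp (2 * s) ≤ ∑ σ, (minorWt V θ σ / Z) * Real.exp (2 * ∑ i, t (σ i)) := by
    have := convexOn_exp.map_sum_le (t := Finset.univ) (w := fun σ => minorWt V θ σ / Z)
      (p := fun σ : α → Fin n => 2 * ∑ i, t (σ i))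
      (fun σ _ => div_nonneg (minorWt_nonneg hθ σ) hZ.le)
      (by rw [← Finset.sum_div]; exact div_self hZ.ne') (fun _ _ => Set.mem_univ _)
    simp only [smul_eq_mul] at this
    refine le_trans (le_of_eq ?_) this
    rw [hs1, Finset.mul_sum]
    congr 1
    exact Finset.sum_congr rfl fun σ _ => by ring
  have hup : ∑ σ, minorWt V θ σ * Real.exp (2 * ∑ i, t (σ i)) ≤
      2 * (((Fintype.card α).factorial : ℝ) *
        gdet (V * Matrix.diagonal fun j => Real.exp (t j))) := by
    rw [factorial_mul_gdet_diagonal, Finset.mul_sum]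
    refine Finset.sum_le_sum fun σ _ => ?_
    rw [← mul_assoc]
    refine mul_le_mul_of_nonneg_right ?_ (Real.exp_pos _).le
    rw [minorWt, mul_comm]
    exact mul_le_mul_of_nonneg_right (hθ _).2 (sq_nonneg _)
  have hmain : gdet V * Real.exp (2 * s) ≤
      2 * gdet (V * Matrix.diagonal fun j => Real.exp (t j)) := by
    have hc : (0 : ℝ) < ((Fintype.card α).factorial : ℝ) := by positivity
    refine le_of_mul_le_mul_left ?_ hc
    calc ((Fintype.card α).factorial : ℝ) * (gdet V * Real.exp (2 * s))
        = (((Fintype.card α).factorial : ℝ) * gdet V) * Real.exp (2 * s) := by ring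
      _ ≤ Z * Real.exp (2 * s) :=
          mul_le_mul_of_nonneg_right (factorial_mul_gdet_le_totalWt hθ) (Real.exp_pos _).le
      _ ≤ Z * ∑ σ, (minorWt V θ σ / Z) * Real.exp (2 * ∑ i, t (σ i)) :=
          mul_le_mul_of_nonneg_left hjensen hZ.le
      _ = ∑ σ, minorWt V θ σ * Real.exp (2 * ∑ i, t (σ i)) := by
          rw [Finset.mul_sum]
          exact Finset.sum_congr rfl fun σ _ => by field_simp
      _ ≤ _ := hup.trans (le_of_eq (by ring))
  have hpos : 0 < gdet V * Real.exp (2 * s) := by positivity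
  have hlog := Real.log_le_log hpos hmain
  rw [Real.log_mul hV.ne' (Real.exp_pos _).ne', Real.log_exp] at hlog
  rw [Real.log_mul two_ne_zero (by intro h; rw [h] at hmain; linarith)] at hlog
  linarith

end weights

section lead
variable {n : ℕ}

open Classical in
/-- The positions of the first nonzero entries of the vectors of `X`. -/
def lead (X : Submodule ℝ (Fin n → ℝ)) : Finset (Fin n) :=
  Finset.univ.filter fun i => ∃ x ∈ X, x i ≠ 0 ∧ ∀ j < i, x j = 0

lemma mem_lead {X : Submodule ℝ (Fin n → ℝ)} {i : Fin n} :
    i ∈ lead X ↔ ∃ x ∈ X, x i ≠ 0 ∧ ∀ j < i, x j = 0 := by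
  simp [lead]

lemma lead_mono {X Y : Submodule ℝ (Fin n → ℝ)} (h : X ≤ Y) : lead X ⊆ lead Y := by
  intro i hi
  obtain ⟨x, hx, hx'⟩ := mem_lead.1 hi
  exact mem_lead.2 ⟨x, h hx, hx'⟩

lemma eq_zero_of_lead {X : Submodule ℝ (Fin n → ℝ)} {x : Fin n → ℝ} (hx : x ∈ X)
    (h : ∀ i ∈ lead X, x i = 0) : x = 0 := by
  by_contra hne
  obtain ⟨i, hi, hmin⟩ := Finset.exists_min_image (Finset.univ.filter fun i => x i ≠ 0) id (by
    obtain ⟨i, hi⟩ := Function.ne_iff.1 hne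
    exact ⟨i, by simpa using hi⟩)
  simp only [Finset.mem_filter, Finset.mem_univ, true_and, id] at hi hmin
  refine hi (h i (mem_lead.2 ⟨x, hx, hi, fun j hj => ?_⟩))
  by_contra hj'
  exact absurd (hmin j hj') (not_le.2 hj)

lemma card_lead_le (X : Submodule ℝ (Fin n → ℝ)) : (lead X).card ≤ Module.finrank ℝ X := by
  have h : ∀ i : lead X, ∃ x ∈ X, x i ≠ 0 ∧ ∀ j < (i : Fin n), x j = 0 := fun i =>
    mem_lead.1 i.2
  choose x hx hxi hxj using h
  have hdet : (Matrix.of fun i j : lead X => x i j).det ≠ 0 := by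
    rw [Matrix.det_of_isUpperTriangular]
    · exact Finset.prod_ne_zero_iff.2 fun i _ => hxi i
    · intro i j hij
      exact hxj i j hij
  have hli : LinearIndependent ℝ fun i => (⟨x i, hx i⟩ : X) := by
    have h1 := Matrix.linearIndependent_rows_of_det_ne_zero hdet
    let p : X →ₗ[ℝ] (lead X → ℝ) := (LinearMap.funLeft ℝ ℝ (fun j : lead X => (j : Fin n))) ∘ₗ X.subtype
    exact LinearIndependent.of_comp p h1
  have := hli.fintype_card_le_finrank
  simpa using this

lemma exists_minor_lead {α : Type*} [Fintype α] [DecidableEq α] {V : Matrix α (Fin n) ℝ}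
    (hV : LinearIndependent ℝ V) :
    (lead (Submodule.span ℝ (Set.range V))).card = Fintype.card α ∧
      ∃ σ : α → Fin n, Finset.univ.image σ = lead (Submodule.span ℝ (Set.range V)) ∧
        (V.submatrix id σ).det ≠ 0 := by
  set X := Submodule.span ℝ (Set.range V) with hX
  have hk : Module.finrank ℝ X = Fintype.card α := finrank_span_eq_card hV
  have hinj : ∀ v : α → ℝ, (∀ j ∈ lead X, (v ᵥ* V) j = 0) → v = 0 := by
    intro v hv
    have hmem : v ᵥ* V ∈ X := by
      rw [Matrix.vecMul_eq_sum]
      exact Submodule.sum_mem _ fun i _ =>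
        Submodule.smul_mem _ _ (Submodule.subset_span (Set.mem_range_self i))
    have h0 := eq_zero_of_lead hmem hv
    rw [Matrix.vecMul_eq_sum] at h0
    exact funext ((Fintype.linearIndependent_iff.1 hV) v h0)
  have hcard : (lead X).card = Fintype.card α := by
    refine le_antisymm (hk ▸ card_lead_le X) ?_
    let p : (α → ℝ) →ₗ[ℝ] (lead X → ℝ) :=
      (LinearMap.funLeft ℝ ℝ (fun j : lead X => (j : Fin n))) ∘ₗ Matrix.vecMulLinear V
    have hp : Function.Injective p := by
      rw [← LinearMap.ker_eq_bot, LinearMap.ker_eq_bot']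
      intro v hv
      exact hinj v fun j hj => congrFun hv ⟨j, hj⟩
    have := LinearMap.finrank_le_finrank_of_injective hp
    simpa using this
  refine ⟨hcard, ?_⟩
  let e : α ≃ lead X := Fintype.equivOfCardEq (by rw [← hcard, Fintype.card_coe])
  refine ⟨fun i => e i, ?_, ?_⟩
  · ext j
    simp only [Finset.mem_image, Finset.mem_univ, true_and]
    constructor
    · rintro ⟨i, rfl⟩
      exact (e i).2
    · intro hj
      exact ⟨e.symm ⟨j, hj⟩, by simp⟩
  · intro h
    obtain ⟨v, hv, hv0⟩ := Matrix.exists_vecMul_eq_zero_iff.2 h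
    refine hv (hinj v fun j hj => ?_)
    have := congrFun hv0 (e.symm ⟨j, hj⟩)
    simpa [Matrix.vecMul, dotProduct] using this

lemma eq_zero_of_nested {κ : Type*} [Fintype κ] {J : κ → Finset (Fin n)}
    (hJ : ∀ a b, a ≠ b → J a ⊂ J b ∨ J b ⊂ J a) (hne : ∀ a, (J a).Nonempty) {c : κ → ℝ}
    (h : ∀ j, ∑ a, (if j ∈ J a then c a else 0) = 0) : c = 0 := by
  classical
  by_contra hc
  have hT : (Finset.univ.filter fun a => c a ≠ 0).Nonempty := by
    obtain ⟨a, ha⟩ := Function.ne_iff.1 hc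
    exact ⟨a, by simpa using ha⟩
  obtain ⟨a, ha, hmax⟩ := Finset.exists_max_image _ (fun a => (J a).card) hT
  simp only [Finset.mem_filter, Finset.mem_univ, true_and] at ha hmax
  have key : ∃ j ∈ J a, ∀ b, b ≠ a → c b ≠ 0 → j ∉ J b := by
    by_cases hT' : (Finset.univ.filter fun b => c b ≠ 0 ∧ b ≠ a).Nonempty
    · obtain ⟨b, hb, hbmax⟩ := Finset.exists_max_image _ (fun a => (J a).card) hT'
      simp only [Finset.mem_filter, Finset.mem_univ, true_and] at hb hbmax
      have hba : J b ⊂ J a := by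
        rcases hJ a b (Ne.symm hb.2) with h1 | h1
        · exact absurd (Finset.card_lt_card h1) (not_lt.2 (hmax b hb.1))
        · exact h1
      obtain ⟨j, hj, hjb⟩ := Finset.exists_of_ssubset hba
      refine ⟨j, hj, fun d hda hcd hjd => ?_⟩
      by_cases hdb : d = b
      · exact hjb (hdb ▸ hjd)
      rcases hJ d b hdb with h1 | h1
      · exact hjb (h1.1 hjd)
      · exact absurd (Finset.card_lt_card h1) (not_lt.2 (hbmax d ⟨hcd, hda⟩))
    · obtain ⟨j, hj⟩ := hne a
      refine ⟨j, hj, fun b hba hcb _ => hT' ⟨b, by simp [hcb, hba]⟩⟩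
  obtain ⟨j, hj, hjb⟩ := key
  have := h j
  rw [Finset.sum_eq_single a] at this
  · rw [if_pos hj] at this
    exact ha this
  · intro b _ hba
    by_cases hcb : c b = 0
    · simp [hcb]
    · rw [if_neg (hjb b hba hcb)]
  · simp

end lead

section generic
variable {n : ℕ}

lemma gdet_ne_zero_iff {κ : Type*} [Fintype κ] [DecidableEq κ] {V : Matrix κ (Fin n) ℝ} :
    gdet V ≠ 0 ↔ ∀ v, v ᵥ* V = 0 → v = 0 := by
  rw [Ne, gdet_eq_zero_iff]
  push Not
  exact forall_congr' fun v => not_imp_not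

lemma dense_gdet_ne_zero {E κ : Type*} [AddCommGroup E] [Module ℝ E] [TopologicalSpace E]
    [IsTopologicalAddGroup E] [ContinuousSMul ℝ E] [Fintype κ] [DecidableEq κ]
    (R : κ → Fin n → E → ℝ) (hR : ∀ a j x y (s : ℝ), R a j (x + s • (y - x)) =
      R a j x + s * (R a j y - R a j x))
    {y : E} (hy : gdet (Matrix.of fun a j => R a j y) ≠ 0) :
    Dense {x | gdet (Matrix.of fun a j => R a j x) ≠ 0} := by
  intro x
  let P : Polynomial ℝ := gdet (Matrix.of fun a j =>
    Polynomial.C (R a j x) + Polynomial.X * Polynomial.C (R a j y - R a j x))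
  have hP : ∀ s : ℝ, P.eval s = gdet (Matrix.of fun a j => R a j (x + s • (y - x))) := by
    intro s
    have := gdet_map (Polynomial.evalRingHom s) (Matrix.of fun a j =>
      Polynomial.C (R a j x) + Polynomial.X * Polynomial.C (R a j y - R a j x))
    rw [Polynomial.coe_evalRingHom] at this
    rw [← this]
    congr 1
    ext a j
    simp [hR]
  have hP0 : P ≠ 0 := by
    intro h
    have h1 := hP 1
    rw [h, one_smul, add_sub_cancel, Polynomial.eval_zero] at h1
    exact hy h1.symm
  have hd : Dense ({s : ℝ | P.eval s = 0}ᶜ) := by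
    refine (Set.Finite.countable ?_).dense_compl ℝ
    refine P.roots.toFinset.finite_toSet.subset fun s hs => ?_
    simpa [hP0] using hs
  have hc : Continuous fun s : ℝ => x + s • (y - x) := by fun_prop
  have h0 : x = (fun s : ℝ => x + s • (y - x)) 0 := by simp
  rw [h0]
  refine map_mem_closure (f := fun s : ℝ => x + s • (y - x)) hc (hd 0) fun s hs => ?_
  have : P.eval s ≠ 0 := hs
  rw [hP] at this
  exact this

lemma exists_generic_weight {ι : Type*} [PartialOrder ι] [BoundedOrder ι] [Countable ι]
    {k : ι → ℕ} (hk : StrictMono k) [Nonempty (Fin n)] (hkn : ∀ W, k W ≤ n)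
    (V : ∀ W, Matrix (Fin (k W)) (Fin n) ℝ) (hV : ∀ W, LinearIndependent ℝ (V W))
    (hmono : ∀ W W', W ≤ W' →
      Submodule.span ℝ (Set.range (V W)) ≤ Submodule.span ℝ (Set.range (V W'))) :
    ∃ θ : Finset (Fin n) → ℝ, (∀ I, 1 ≤ θ I ∧ θ I ≤ 2) ∧
      ∀ S : Finset ι, IsChain (· ≤ ·) (S : Set ι) → ⊥ ∉ S → ⊤ ∉ S → ∀ c : ι → ℝ,
        ∑ W ∈ S, c W • meanSlope (V W) θ = 0 → ∀ W ∈ S, c W = 0 := by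
  classical
  let R : ∀ S : Finset ι, Option S → Fin n → (Finset (Fin n) → ℝ) → ℝ := fun S a j θ =>
    a.elim 1 fun W => rawSlope (V W) θ j
  have hRaff : ∀ S a j x y (s : ℝ), R S a j (x + s • (y - x)) =
      R S a j x + s * (R S a j y - R S a j x) := by
    intro S a j x y s
    rcases a with _ | W
    · simp [R]
    · simp only [R, Option.elim, rawSlope, minorWt, ← Finset.sum_sub_distrib, Finset.mul_sum,
        ← Finset.sum_add_distrib]
      refine Finset.sum_congr rfl fun σ _ => ?_
      simp only [Pi.add_apply, Pi.smul_apply, Pi.sub_apply, smul_eq_mul]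
      ring
  have hRcont : ∀ S, Continuous fun θ => gdet (Matrix.of fun a j => R S a j θ) := by
    intro S
    have : Continuous fun θ => (Matrix.of fun a j => R S a j θ) := by
      refine continuous_matrix fun a j => ?_
      rcases a with _ | W
      · exact continuous_const
      · simp only [R, Option.elim, rawSlope, minorWt, Matrix.of_apply]
        fun_prop
    exact (this.matrix_mul this.matrix_transpose).matrix_det
  have hI : ∀ W, (lead (Submodule.span ℝ (Set.range (V W)))).card = k W := fun W => by
    rw [(exists_minor_lead (hV W)).1, Fintype.card_fin]
  let Good : Finset ι → Prop := fun S => IsChain (· ≤ ·) (S : Set ι) ∧ ⊥ ∉ S ∧ ⊤ ∉ S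
  have hdense : ∀ S, Good S → Dense {θ | gdet (Matrix.of fun a j => R S a j θ) ≠ 0} := by
    rintro S ⟨hS, hb, ht⟩
    let I : ι → Finset (Fin n) := fun W => lead (Submodule.span ℝ (Set.range (V W)))
    let θ₀ : Finset (Fin n) → ℝ := fun J => if ∃ W ∈ S, I W = J then 1 else 0
    refine dense_gdet_ne_zero (R S) (hRaff S) (y := θ₀) ?_
    have hlt : ∀ W ∈ S, ∀ W' ∈ S, W ≠ W' → I W ⊂ I W' ∨ I W' ⊂ I W := by
      have : ∀ W W', W < W' → I W ⊂ I W' := fun W W' h => by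
        refine (lead_mono (hmono _ _ h.le)).ssubset_of_ne fun he => ?_
        have h1 := congrArg Finset.card he
        simp only [hI] at h1
        exact absurd (hk h) (by omega)
      intro W hW W' hW' hne
      rcases hS hW hW' hne with h | h
      · exact Or.inl (this _ _ (lt_of_le_of_ne h hne))
      · exact Or.inr (this _ _ (lt_of_le_of_ne h hne.symm))
    have hraw : ∀ W ∈ S, ∃ a : ℝ, a ≠ 0 ∧
        ∀ j, rawSlope (V W) θ₀ j = if j ∈ I W then a else 0 := by
      intro W hW
      have hmult : ∀ σ : Fin (k W) → Fin n, ((V W).submatrix id σ).det ≠ 0 →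
          ∀ j, mult σ j = if j ∈ Finset.univ.image σ then 1 else 0 := by
        intro σ hσ j
        have hinj : Function.Injective σ := by
          intro i i' hii
          by_contra hne
          exact hσ (Matrix.det_zero_of_column_eq hne fun l => by simp [hii])
        split_ifs with hj
        · obtain ⟨i, -, rfl⟩ := Finset.mem_image.1 hj
          rw [mult, Finset.sum_eq_single i]
          · simp
          · intro b _ hb
            rw [if_neg fun h => hb (hinj h)]
          · simp
        · refine Finset.sum_eq_zero fun i _ => if_neg ?_
          rintro rfl
          exact hj (Finset.mem_image_of_mem _ (Finset.mem_univ i))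
      have himg : ∀ σ : Fin (k W) → Fin n, minorWt (V W) θ₀ σ ≠ 0 →
          Finset.univ.image σ = I W := by
        intro σ hσ
        have hdet : ((V W).submatrix id σ).det ≠ 0 := fun h => hσ (by simp [minorWt, h])
        have hθ : θ₀ (Finset.univ.image σ) ≠ 0 := right_ne_zero_of_mul hσ
        have hex : ∃ W' ∈ S, I W' = Finset.univ.image σ := by
          by_contra h
          exact hθ (if_neg h)
        obtain ⟨W', hW', he⟩ := hex
        have hcard : (Finset.univ.image σ).card = k W := by
          rw [Finset.card_image_of_injective, Finset.card_univ, Fintype.card_fin]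
          intro i i' hii
          by_contra hne
          exact hdet (Matrix.det_zero_of_column_eq hne fun l => by simp [hii])
        by_cases hWW : W = W'
        · rw [← he, hWW]
        · have h1 : (I W).card = (I W').card := by rw [he, hcard]; exact hI W
          rcases hlt W hW W' hW' hWW with h | h
          · exact absurd (Finset.card_lt_card h) (by omega)
          · exact absurd (Finset.card_lt_card h) (by omega)
      have hθ₀ : ∀ J, 0 ≤ θ₀ J := fun J => by
        simp only [θ₀]
        split_ifs <;> norm_num
      refine ⟨∑ σ, minorWt (V W) θ₀ σ, ?_, fun j => ?_⟩
      · obtain ⟨-, σ, hσ, hdet⟩ := exists_minor_lead (hV W)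
        refine (Finset.sum_pos' (fun σ _ => mul_nonneg (sq_nonneg _) (hθ₀ _))
          ⟨σ, Finset.mem_univ _, ?_⟩).ne'
        have : θ₀ (Finset.univ.image σ) = 1 := if_pos ⟨W, hW, hσ.symm⟩
        change 0 < _ * θ₀ (Finset.univ.image σ)
        rw [this]
        positivity
      · have : ∀ σ, minorWt (V W) θ₀ σ * mult σ j =
            if j ∈ I W then minorWt (V W) θ₀ σ else 0 := by
          intro σ
          by_cases h0 : minorWt (V W) θ₀ σ = 0
          · simp [h0]
          · have hdet : ((V W).submatrix id σ).det ≠ 0 := fun h => h0 (by simp [minorWt, h])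
            rw [hmult σ hdet, himg σ h0]
            simp
        rw [rawSlope, Finset.sum_congr rfl fun σ _ => this σ]
        split_ifs <;> simp
    choose! a ha0 ha using hraw
    rw [gdet_ne_zero_iff]
    intro c hc
    let J : Option S → Finset (Fin n) := fun o => o.elim Finset.univ fun W => I W
    let c' : Option S → ℝ := fun o => c o * o.elim 1 fun W => a W
    have hpos : ∀ W ∈ S, 0 < k W ∧ k W < n := by
      intro W hW
      have h1 : ⊥ < W := bot_lt_iff_ne_bot.2 fun h => hb (h ▸ hW)
      have h2 : W < ⊤ := lt_top_iff_ne_top.2 fun h => ht (h ▸ hW)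
      exact ⟨lt_of_le_of_lt (Nat.zero_le _) (hk h1), lt_of_lt_of_le (hk h2) (hkn _)⟩
    have hIuniv : ∀ W ∈ S, I W ⊂ Finset.univ := fun W hW => by
      rw [Finset.ssubset_univ_iff]
      intro h
      have h1 := congrArg Finset.card h
      simp only [I, hI, Finset.card_univ, Fintype.card_fin] at h1
      exact absurd (hpos W hW).2 (by omega)
    have hzero : c' = 0 := by
      refine eq_zero_of_nested (J := J) ?_ ?_ fun j => ?_
      · rintro (_ | W) (_ | W') hne
        · exact absurd rfl hne
        · exact Or.inr (hIuniv W' W'.2)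
        · exact Or.inl (hIuniv W W.2)
        · exact hlt W W.2 W' W'.2 fun h => hne (by rw [Subtype.ext h])
      · rintro (_ | W)
        · obtain ⟨j⟩ := (inferInstance : Nonempty (Fin n))
          exact ⟨j, Finset.mem_univ j⟩
        · rw [← Finset.card_pos]
          exact lt_of_lt_of_eq (hpos W W.2).1 (hI W).symm
      · refine Eq.trans ?_ (congrFun hc j)
        refine Finset.sum_congr rfl fun o _ => ?_
        rcases o with _ | W
        · simp [J, c', R]
        · simp only [J, c', R, Option.elim, Matrix.of_apply, ha W W.2, mul_ite, mul_zero]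
          by_cases hj : j ∈ I W <;> simp only [hj, if_true, if_false]
    funext o
    have h1 := congrFun hzero o
    rcases o with _ | W
    · simpa [c'] using h1
    · simpa [c', ha0 W W.2] using h1
  have hcount : Countable {S : Finset ι // Good S} := inferInstance
  have hD : Dense (⋂ S : {S : Finset ι // Good S},
      {θ | gdet (Matrix.of fun a j => R S.1 a j θ) ≠ 0}) := by
    refine dense_iInter_of_isOpen (fun S => ?_) fun S => hdense S.1 S.2
    exact isOpen_ne.preimage (hRcont S.1)
  obtain ⟨θ, hθD, hθ⟩ := hD.exists_mem_open (U := Set.pi Set.univ fun _ => Set.Ioo (1 : ℝ) 2)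
    (isOpen_set_pi Set.finite_univ fun _ _ => isOpen_Ioo) ⟨fun _ => 3 / 2, fun _ _ => by
      constructor <;> norm_num⟩
  refine ⟨θ, fun I => ⟨(hθ I trivial).1.le, (hθ I trivial).2.le⟩, ?_⟩
  intro S hS hb ht c hc
  have hg := gdet_ne_zero_iff.1 (Set.mem_iInter.1 hθD ⟨S, hS, hb, ht⟩)
  have hθ12 : ∀ I, 1 ≤ θ I ∧ θ I ≤ 2 := fun I => ⟨(hθ I trivial).1.le, (hθ I trivial).2.le⟩
  let v : Option S → ℝ := fun o =>
    o.elim (-∑ W ∈ S, c W * (k W / n)) fun W => c W / totalWt (V W) θ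
  have hv : v = 0 := by
    refine hg v ?_
    funext j
    have h1 := congrFun hc j
    rw [Finset.sum_apply] at h1
    simp only [Pi.smul_apply, smul_eq_mul, meanSlope, Fintype.card_fin, mul_sub,
      Finset.sum_sub_distrib, Pi.zero_apply] at h1
    simp only [Matrix.vecMul, dotProduct, Fintype.sum_option, Matrix.of_apply, v, R, Option.elim,
      mul_one, Pi.zero_apply]
    rw [Finset.sum_coe_sort S fun W => c W / totalWt (V W) θ * rawSlope (V W) θ j]
    rw [← h1, neg_add_eq_sub]
    congr 1
    exact Finset.sum_congr rfl fun W _ => by ring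
  intro W hW
  have h1 := congrFun hv (some ⟨W, hW⟩)
  have hZ : 0 < totalWt (V W) θ := by
    refine totalWt_pos hθ12 (lt_of_le_of_ne (gdet_nonneg _) (Ne.symm ?_))
    rw [gdet_ne_zero_iff]
    intro w hw
    rw [Matrix.vecMul_eq_sum] at hw
    exact funext ((Fintype.linearIndependent_iff.1 (hV W)) w hw)
  simpa [v, hZ.ne'] using h1

end generic

section finiteness
variable {n : ℕ}

lemma adjugate_mul_apply {α : Type*} [Fintype α] [DecidableEq α] (w : Matrix α (Fin n) ℤ)
    (τ : α → Fin n) (i : α) (j : Fin n) :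
    ((w.submatrix id τ).adjugate * w) i j = (w.submatrix id (Function.update τ i j)).det := by
  have h1 : ((w.submatrix id τ).adjugate * w) i j =
      ((w.submatrix id τ).adjugate *ᵥ fun l => w l j) i := rfl
  rw [h1, ← Matrix.cramer_eq_adjugate_mulVec, Matrix.cramer_apply]
  congr 1
  ext l m
  by_cases hm : m = i
  · subst hm
    simp
  · simp [hm]

lemma span_le_of_minors_eq {α : Type*} [Fintype α] [DecidableEq α] {w w' : Matrix α (Fin n) ℤ}
    (hw : LinearIndependent ℤ w)
    (h : ∀ σ : α → Fin n, (w.submatrix id σ).det = (w'.submatrix id σ).det) :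
    ∃ p : ℤ, p ≠ 0 ∧ ∀ i, p • w i ∈ Submodule.span ℤ (Set.range w') := by
  have hg : gdet w ≠ 0 := by
    rw [Ne, gdet_eq_zero_iff]
    rintro ⟨v, hv, hv0⟩
    rw [Matrix.vecMul_eq_sum] at hv0
    exact hv (funext ((Fintype.linearIndependent_iff.1 hw) v hv0))
  obtain ⟨τ, hτ⟩ : ∃ τ : α → Fin n, (w.submatrix id τ).det ≠ 0 := by
    by_contra hcon
    push Not at hcon
    have := factorial_mul_gdet w
    rw [Finset.sum_eq_zero fun σ _ => by rw [hcon σ]; simp] at this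
    have hf : ((Fintype.card α).factorial : ℤ) ≠ 0 := by positivity
    exact (mul_ne_zero hf hg) this
  refine ⟨_, hτ, fun i => ?_⟩
  have h1 : (w.submatrix id τ).adjugate * w = (w'.submatrix id τ).adjugate * w' := by
    ext i j
    rw [adjugate_mul_apply, adjugate_mul_apply, h]
  have h2 : (w.submatrix id τ).det • w =
      ((w.submatrix id τ) * (w'.submatrix id τ).adjugate) * w' := by
    rw [Matrix.mul_assoc, ← h1, ← Matrix.mul_assoc, Matrix.mul_adjugate, Matrix.smul_mul,
      Matrix.one_mul]
  have h3 : (w.submatrix id τ).det • w i =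
      ∑ l, ((w.submatrix id τ) * (w'.submatrix id τ).adjugate) i l • w' l := by
    funext j
    have := congrFun (congrFun h2 i) j
    rw [Matrix.mul_apply] at this
    simpa [Finset.sum_apply] using this
  rw [h3]
  exact Submodule.sum_mem _ fun l _ =>
    Submodule.smul_mem _ _ (Submodule.subset_span (Set.mem_range_self l))

lemma le_of_minors_eq {α : Type*} [Fintype α] [DecidableEq α] {w w' : Matrix α (Fin n) ℤ}
    {W W' : Submodule ℚ (Fin n → ℚ)} (hw : LinearIndependent ℤ w)
    (hW : Submodule.span ℤ (Set.range w) = intPts W)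
    (hW' : Submodule.span ℤ (Set.range w') = intPts W')
    (h : ∀ σ : α → Fin n, (w.submatrix id σ).det = (w'.submatrix id σ).det) : W ≤ W' := by
  obtain ⟨p, hp, hmem⟩ := span_le_of_minors_eq hw h
  rw [← span_ratCast_eq hW, Submodule.span_le]
  rintro _ ⟨i, rfl⟩
  have := hmem i
  rw [hW'] at this
  exact mem_intPts.1 (intPts_saturated W' p _ hp this)

lemma abs_minor_le {α : Type*} [Fintype α] [DecidableEq α] {G : Matrix (Fin n) (Fin n) ℝ}
    (hG : G.det ≠ 0) {M : ℝ} {w : Matrix α (Fin n) ℤ} (hM : latDet G w ≤ M) (σ : α → Fin n) :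
    |(((w.submatrix id σ).det : ℤ) : ℝ)| ≤ ∑ τ : α → Fin n, |∏ i, G⁻¹ (τ i) (σ i)| *
      Real.sqrt ((Fintype.card α).factorial * M) := by
  set V : Matrix α (Fin n) ℝ := w.map (Int.cast : ℤ → ℝ) * G with hV
  have hVτ : ∀ τ : α → Fin n, |(V.submatrix id τ).det| ≤
      Real.sqrt ((Fintype.card α).factorial * M) := by
    intro τ
    refine Real.abs_le_sqrt ?_
    have h1 := factorial_mul_gdet V
    have h2 : ((Fintype.card α).factorial : ℝ) * gdet V ≤ (Fintype.card α).factorial * M :=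
      mul_le_mul_of_nonneg_left hM (by positivity)
    refine le_trans ?_ h2
    rw [h1]
    exact Finset.single_le_sum (f := fun τ : α → Fin n => (V.submatrix id τ).det ^ 2)
      (fun _ _ => sq_nonneg _) (Finset.mem_univ τ)
  have h1 : (((w.submatrix id σ).det : ℤ) : ℝ) =
      ((G⁻¹.submatrix id σ)ᵀ * Vᵀ).det := by
    rw [← Matrix.transpose_mul, Matrix.det_transpose]
    have h2 : V * G⁻¹.submatrix id σ = (w.submatrix id σ).map (Int.castRingHom ℝ) := by
      have h3 : V * G⁻¹ = w.map (Int.cast : ℤ → ℝ) := by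
        rw [hV, Matrix.mul_assoc, Matrix.mul_nonsing_inv _ (isUnit_iff_ne_zero.2 hG),
          Matrix.mul_one]
      ext i j
      have := congrFun (congrFun h3 i) (σ j)
      rw [Matrix.mul_apply] at this ⊢
      exact this
    rw [h2]
    exact (Int.castRingHom ℝ).map_det _
  rw [h1, det_mul_eq_sum]
  refine (Finset.abs_sum_le_sum_abs _ _).trans (Finset.sum_le_sum fun τ _ => ?_)
  rw [abs_mul]
  have h4 : (Vᵀ.submatrix τ id).det = (V.submatrix id τ).det := by
    rw [← Matrix.det_transpose]
    rfl
  rw [h4]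
  exact mul_le_mul_of_nonneg_left (hVτ τ) (abs_nonneg _)

lemma finite_subDet_le {G : Matrix (Fin n) (Fin n) ℝ} (hG : G.det ≠ 0) (M : ℝ) :
    {W : Submodule ℚ (Fin n → ℚ) | subDet G W ≤ M}.Finite := by
  have hk : ∀ k : ℕ, {W : Submodule ℚ (Fin n → ℚ) | ∃ w : Matrix (Fin k) (Fin n) ℤ,
      LinearIndependent ℤ w ∧ Submodule.span ℤ (Set.range w) = intPts W ∧
        latDet G w ≤ M}.Finite := by
    intro k
    set T := {W : Submodule ℚ (Fin n → ℚ) | ∃ w : Matrix (Fin k) (Fin n) ℤ,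
      LinearIndependent ℤ w ∧ Submodule.span ℤ (Set.range w) = intPts W ∧
        latDet G w ≤ M} with hT
    have hT' : ∀ W ∈ T, ∃ w : Matrix (Fin k) (Fin n) ℤ,
      LinearIndependent ℤ w ∧ Submodule.span ℤ (Set.range w) = intPts W ∧
        latDet G w ≤ M := fun W hW => hW
    choose! w hw1 hw2 hw3 using hT'
    let B : (Fin k → Fin n) → ℝ := fun σ => ∑ τ : Fin k → Fin n, |∏ i, G⁻¹ (τ i) (σ i)| *
      Real.sqrt ((Fintype.card (Fin k)).factorial * M)
    let P : Submodule ℚ (Fin n → ℚ) → (Fin k → Fin n) → ℤ := fun W σ =>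
      ((w W).submatrix id σ).det
    have himg : (P '' T) ⊆ Set.pi Set.univ fun σ => Set.Icc (-⌈B σ⌉) ⌈B σ⌉ := by
      rintro _ ⟨W, hW, rfl⟩ σ -
      have h1 := abs_le.1 (abs_minor_le hG (hw3 W hW) σ)
      have h2 : B σ ≤ (⌈B σ⌉ : ℝ) := Int.le_ceil _
      constructor
      · have : ((-⌈B σ⌉ : ℤ) : ℝ) ≤ (P W σ : ℝ) := by
          push_cast
          exact le_trans (neg_le_neg h2) h1.1
        exact_mod_cast this
      · have : (P W σ : ℝ) ≤ ((⌈B σ⌉ : ℤ) : ℝ) := h1.2.trans h2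
        exact_mod_cast this
    refine Set.Finite.of_finite_image ((Set.Finite.pi' fun σ => Set.finite_Icc (-⌈B σ⌉) ⌈B σ⌉).subset ?_) ?_
      (f := P)
    · exact fun x hx σ => himg hx σ trivial
    · intro W hW W' hW' he
      exact le_antisymm
        (le_of_minors_eq (hw1 W hW) (hw2 W hW) (hw2 W' hW') fun σ => congrFun he σ)
        (le_of_minors_eq (hw1 W' hW') (hw2 W' hW') (hw2 W hW) fun σ => (congrFun he σ).symm)
  refine ((Set.finite_Iic n).biUnion fun k _ => hk k).subset fun W hW => ?_
  refine Set.mem_biUnion (x := Module.finrank ℚ W) ?_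
    ⟨intBasis W, linearIndependent_intBasis W, span_intBasis W, hW⟩
  have := Submodule.finrank_le W
  simpa using this

end finiteness

section torus
variable {n : ℕ}

lemma countable_submodule_rat : Countable (Submodule ℚ (Fin n → ℚ)) := by
  have : Function.Surjective fun s : Finset (Fin n → ℚ) =>
      Submodule.span ℚ (s : Set (Fin n → ℚ)) := fun W => IsNoetherian.noetherian W
  exact this.countable

/-- A real basis adapted to a rational subspace, moved by `G`. -/
def realBasis (G : Matrix (Fin n) (Fin n) ℝ) (W : Submodule ℚ (Fin n → ℚ)) :
    Matrix (Fin (Module.finrank ℚ W)) (Fin n) ℝ :=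
  (intBasis W).map (Int.cast : ℤ → ℝ) * G

lemma subDet_eq_gdet_realBasis (G : Matrix (Fin n) (Fin n) ℝ) (W : Submodule ℚ (Fin n → ℚ)) :
    subDet G W = gdet (realBasis G W) := rfl

lemma subDet_mul (G D : Matrix (Fin n) (Fin n) ℝ) (W : Submodule ℚ (Fin n → ℚ)) :
    subDet (G * D) W = gdet (realBasis G W * D) := by
  rw [subDet_eq_gdet_realBasis, realBasis, realBasis, Matrix.mul_assoc]

lemma linearIndependent_of_gdet_ne_zero {κ : Type*} [Fintype κ] [DecidableEq κ]
    {V : Matrix κ (Fin n) ℝ} (h : gdet V ≠ 0) : LinearIndependent ℝ V := by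
  refine Fintype.linearIndependent_iff.2 fun g hg => ?_
  have := gdet_ne_zero_iff.1 h g (by rw [Matrix.vecMul_eq_sum]; exact hg)
  exact congrFun this

lemma span_realBasis_mono (G : Matrix (Fin n) (Fin n) ℝ) {W W' : Submodule ℚ (Fin n → ℚ)}
    (h : W ≤ W') : Submodule.span ℝ (Set.range (realBasis G W)) ≤
      Submodule.span ℝ (Set.range (realBasis G W')) := by
  rw [Submodule.span_le]
  rintro _ ⟨i, rfl⟩
  have h1 : intBasis W i ∈ Submodule.span ℤ (Set.range (intBasis W')) := by
    rw [span_intBasis]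
    apply intPts_mono h
    rw [← span_intBasis]
    exact Submodule.subset_span ⟨i, rfl⟩
  obtain ⟨c, hc⟩ := (Submodule.mem_span_range_iff_exists_fun ℤ).1 h1
  refine (Submodule.mem_span_range_iff_exists_fun ℝ).2 ⟨fun j => (c j : ℝ), ?_⟩
  funext l
  have h2 : ∀ m, (intBasis W i m : ℝ) = ∑ j, (c j : ℝ) * intBasis W' j m := by
    intro m
    rw [← hc]
    simp
  simp only [Finset.sum_apply, Pi.smul_apply, smul_eq_mul, realBasis, Matrix.mul_apply,
    Matrix.map_apply, h2, Finset.mul_sum, Finset.sum_mul]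
  rw [Finset.sum_comm]
  exact Finset.sum_congr rfl fun _ _ => Finset.sum_congr rfl fun _ _ => by ring

lemma continuous_gdet {X κ : Type*} [TopologicalSpace X] [Fintype κ] [DecidableEq κ]
    {V : X → Matrix κ (Fin n) ℝ} (hV : Continuous V) : Continuous fun x => gdet (V x) :=
  (hV.matrix_mul hV.matrix_transpose).matrix_det

lemma det_mul_diagonal_exp (G : Matrix (Fin n) (Fin n) ℝ) (t : Fin n → ℝ) :
    (G * diagonal fun j => Real.exp (t j)).det = G.det * Real.exp (∑ i, t i) := by
  rw [Matrix.det_mul, Matrix.det_diagonal, Real.exp_sum]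

/-- Every unimodular lattice has a point in its orbit under the diagonal group all of whose
subgroups have covolume at least one. -/
theorem exists_diagonal_forall_one_le_latDet (hn : 0 < n) {G : Matrix (Fin n) (Fin n) ℝ}
    (hG : G.det ^ 2 = 1) :
    ∃ t : Fin n → ℝ, ∑ i, t i = 0 ∧ ∀ (k : ℕ) (w : Matrix (Fin k) (Fin n) ℤ),
      LinearIndependent ℤ w → 1 ≤ latDet (G * diagonal fun j => Real.exp (t j)) w := by
  have hG0 : G.det ≠ 0 := fun h => by simp [h] at hG
  have hD : ∀ t : Fin n → ℝ, (G * diagonal fun j => Real.exp (t j)).det ≠ 0 := fun t => by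
    rw [det_mul_diagonal_exp]
    exact mul_ne_zero hG0 (Real.exp_ne_zero _)
  have hV0 : ∀ W, 0 < gdet (realBasis G W) := subDet_pos hG0
  have : Nonempty (Fin n) := ⟨⟨0, hn⟩⟩
  have := countable_submodule_rat (n := n)
  have hk : StrictMono fun W : Submodule ℚ (Fin n → ℚ) => Module.finrank ℚ W :=
    fun _ _ h => Submodule.finrank_lt_finrank_of_lt h
  have hkn : ∀ W : Submodule ℚ (Fin n → ℚ), Module.finrank ℚ W ≤ n := fun W => by
    simpa using Submodule.finrank_le W
  obtain ⟨θ, hθ, hind⟩ := exists_generic_weight hk hkn (realBasis G)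
    (fun W => linearIndependent_of_gdet_ne_zero (hV0 W).ne')
    (fun W W' h => span_realBasis_mono G h)
  obtain ⟨t, ht, htW⟩ := exists_common_nonneg hn hk hkn
    (fun W W' => by
      have := Submodule.finrank_sup_add_finrank_inf_eq W W'
      lia)
    (q := fun W => meanSlope (realBasis G W) θ)
    (h := fun W => Real.log (gdet (realBasis G W)) / 2 - Real.log 2 / 2)
    (f := fun W t => Real.log (subDet (G * diagonal fun j => Real.exp (t j)) W) / 2)
    (Q := n + 1)
    (fun W => norm_meanSlope_le hn (by simpa using hkn W) hθ (hV0 W)) (by positivity)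
    (fun W => sum_meanSlope hn hθ (hV0 W))
    (fun M => by
      refine (finite_subDet_le hG0 (Real.exp (2 * M + Real.log 2))).subset fun W hW => ?_
      have hW' : Real.log (gdet (realBasis G W)) / 2 - Real.log 2 / 2 ≤ M := hW
      have : Real.log (subDet G W) ≤ 2 * M + Real.log 2 := by
        rw [subDet_eq_gdet_realBasis]; linarith
      exact (Real.log_le_iff_le_exp (hV0 W)).1 this)
    (fun S h1 h2 h3 c _ hc => hind S h1 h2 h3 c hc)
    (fun W => by
      refine Continuous.div_const (Continuous.log ?_ fun t => (subDet_pos (hD t) W).ne') 2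
      simp only [subDet_eq_gdet_realBasis, realBasis]
      refine continuous_gdet (continuous_const.matrix_mul (continuous_const.matrix_mul ?_))
      exact Continuous.matrix_diagonal (by fun_prop))
    (fun W t ht => by
      simp only [subDet_mul]
      exact log_gdet_lower hθ (hV0 W) t ht)
    (fun W W' t ht => by
      have h1 := fun W => subDet_pos (hD t) W
      have h2 := Real.log_le_log (mul_pos (h1 _) (h1 _)) (subDet_submodular (hD t) W W')
      rw [Real.log_mul (h1 _).ne' (h1 _).ne', Real.log_mul (h1 _).ne' (h1 _).ne'] at h2
      linarith)
    (fun t ht => by simp [subDet_bot])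
    (fun t ht => by
      simp only [subDet_top (hD t), det_mul_diagonal_exp, ht, Real.exp_zero, mul_one, hG]
      simp)
  refine ⟨t, ht, fun k w hw => ?_⟩
  obtain ⟨W, hW⟩ := exists_subDet_le_latDet (hD t) hw
  refine le_trans ?_ hW
  have h1 := htW W
  exact (Real.log_nonneg_iff (subDet_pos (hD t) W)).1 (by linarith)

end torus

section stability
variable {n : ℕ}

lemma gvol_eq_sqrt_gdet {r : ℕ} (v : Matrix (Fin r) (Fin n) ℝ) :
    SW.gvol v = Real.sqrt (gdet v) := rfl

lemma mem_closure_range_iff {r : ℕ} {G : Matrix (Fin r) (Fin n) ℝ} {x : Fin n → ℝ} :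
    x ∈ AddSubgroup.closure (Set.range G) ↔ ∃ m : Fin r → ℤ, x = (fun i => (m i : ℝ)) ᵥ* G := by
  rw [← Submodule.span_int_eq_addSubgroupClosure, Submodule.mem_toAddSubgroup]
  refine (Submodule.mem_span_range_iff_exists_fun ℤ).trans (exists_congr fun m => ?_)
  rw [Matrix.vecMul_eq_sum, eq_comm]
  simp only [Int.cast_smul_eq_zsmul]

lemma det_ne_zero_of_linearIndependent {G : Matrix (Fin n) (Fin n) ℝ}
    (h : LinearIndependent ℝ G) : G.det ≠ 0 := by
  rw [← isUnit_iff_ne_zero, ← Matrix.isUnit_iff_isUnit_det]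
  exact Matrix.linearIndependent_rows_iff_isUnit.1 h

lemma linearIndependent_of_det_ne_zero {G : Matrix (Fin n) (Fin n) ℝ}
    (h : G.det ≠ 0) : LinearIndependent ℝ G := by
  rw [← isUnit_iff_ne_zero, ← Matrix.isUnit_iff_isUnit_det] at h
  exact Matrix.linearIndependent_rows_iff_isUnit.2 h

lemma sqrt_gdet_square (G : Matrix (Fin n) (Fin n) ℝ) : Real.sqrt (gdet G) = |G.det| := by
  rw [gdet_square, Real.sqrt_sq_eq_abs]

/-- An independent family in the lattice with basis `G` has integral coordinates. -/
lemma exists_int_coords {r : ℕ} {G : Matrix (Fin n) (Fin n) ℝ} {v : Matrix (Fin r) (Fin n) ℝ}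
    (hv : ∀ i, v i ∈ AddSubgroup.closure (Set.range G)) :
    ∃ w : Matrix (Fin r) (Fin n) ℤ, v = w.map (Int.cast : ℤ → ℝ) * G := by
  choose w hw using fun i => mem_closure_range_iff.1 (hv i)
  refine ⟨Matrix.of w, ?_⟩
  funext i
  rw [hw i]
  rfl

lemma linearIndependent_int_of_real {r : ℕ} {G : Matrix (Fin n) (Fin n) ℝ}
    {w : Matrix (Fin r) (Fin n) ℤ}
    (hv : LinearIndependent ℝ (w.map (Int.cast : ℤ → ℝ) * G)) : LinearIndependent ℤ w := by
  refine Fintype.linearIndependent_iff.2 fun c hc i => ?_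
  have h2 : (fun i => (c i : ℝ)) ᵥ* (w.map (Int.cast : ℤ → ℝ) * G) = 0 := by
    rw [← Matrix.vecMul_vecMul]
    have h1 : (fun i => (c i : ℝ)) ᵥ* w.map (Int.cast : ℤ → ℝ) = 0 := by
      funext j
      have := congrFun hc j
      simp only [Finset.sum_apply, Pi.smul_apply, smul_eq_mul, Pi.zero_apply] at this
      simp only [Matrix.vecMul, dotProduct, Matrix.map_apply, Pi.zero_apply]
      exact_mod_cast this
    rw [h1, Matrix.zero_vecMul]
  rw [Matrix.vecMul_eq_sum] at h2
  exact_mod_cast Fintype.linearIndependent_iff.1 hv _ h2 i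

/-- Every subgroup of the lattice with basis `G` has an integral basis. -/
lemma exists_int_basis_of_le {G : Matrix (Fin n) (Fin n) ℝ} {Λ : AddSubgroup (Fin n → ℝ)}
    (h : Λ ≤ AddSubgroup.closure (Set.range G)) :
    ∃ (k : ℕ) (w : Matrix (Fin k) (Fin n) ℤ), LinearIndependent ℤ w ∧
      Λ = AddSubgroup.closure (Set.range (w.map (Int.cast : ℤ → ℝ) * G)) := by
  let φ : (Fin n → ℤ) →+ (Fin n → ℝ) :=
    { toFun := fun m => (fun i => (m i : ℝ)) ᵥ* G
      map_zero' := by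
        rw [← Matrix.zero_vecMul G]
        congr 1
        funext i
        simp
      map_add' := fun a b => by
        rw [← Matrix.add_vecMul]
        congr 1
        funext i
        simp }
  obtain ⟨k, w, hw, hs⟩ := exists_basis_family (AddSubgroup.toIntSubmodule (Λ.comap φ))
  refine ⟨k, w, hw, ?_⟩
  have h1 : Λ.comap φ = AddSubgroup.closure (Set.range w) := by
    rw [← Submodule.span_int_eq_addSubgroupClosure, hs]
    rfl
  have h2 : (Λ.comap φ).map φ = Λ := by
    refine AddSubgroup.map_comap_eq_self fun x hx => ?_
    obtain ⟨m, hm⟩ := mem_closure_range_iff.1 (h hx)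
    exact ⟨m, hm.symm⟩
  rw [← h2, h1, AddMonoidHom.map_closure, ← Set.range_comp]
  rfl

lemma le_closure_of_eq {r : ℕ} {Λ : AddSubgroup (Fin n → ℝ)} {v : Fin r → Fin n → ℝ}
    (h : Λ = AddSubgroup.closure (Set.range v)) (i : Fin r) : v i ∈ Λ :=
  h ▸ AddSubgroup.subset_closure ⟨i, rfl⟩

lemma one_le_of_covolSpec {G : Matrix (Fin n) (Fin n) ℝ}
    (hw : ∀ (k : ℕ) (w : Matrix (Fin k) (Fin n) ℤ), LinearIndependent ℤ w → 1 ≤ latDet G w)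
    {Λ : AddSubgroup (Fin n → ℝ)} (h : Λ ≤ AddSubgroup.closure (Set.range G)) {c : ℝ}
    (hc : SW.covolSpec Λ c) : 1 ≤ c := by
  obtain ⟨r, v, hv, hΛ, rfl⟩ := hc
  obtain ⟨w, rfl⟩ := exists_int_coords (v := v) fun i => h (le_closure_of_eq hΛ i)
  rw [gvol_eq_sqrt_gdet, Real.one_le_sqrt]
  exact hw r w (linearIndependent_int_of_real hv)

lemma one_le_covol {G : Matrix (Fin n) (Fin n) ℝ} (hG : G.det ≠ 0)
    (hw : ∀ (k : ℕ) (w : Matrix (Fin k) (Fin n) ℤ), LinearIndependent ℤ w → 1 ≤ latDet G w)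
    {Λ : AddSubgroup (Fin n → ℝ)} (h : Λ ≤ AddSubgroup.closure (Set.range G)) :
    1 ≤ SW.covol Λ := by
  refine le_csInf ?_ fun c hc => one_le_of_covolSpec hw h hc
  obtain ⟨k, w, hi, hΛ⟩ := exists_int_basis_of_le h
  exact ⟨_, k, _, linearIndependent_of_gdet_ne_zero (latDet_pos hG hi).ne', hΛ, rfl⟩

lemma span_closure_range {G : Matrix (Fin n) (Fin n) ℝ} (hG : G.det ≠ 0) :
    Submodule.span ℝ (AddSubgroup.closure (Set.range G) : Set (Fin n → ℝ)) = ⊤ := by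
  refine top_le_iff.1 ?_
  rw [← (linearIndependent_of_det_ne_zero hG).span_eq_top_of_card_eq_finrank' (by simp)]
  exact Submodule.span_mono AddSubgroup.subset_closure

/-- The basis of `ℝⁿ` given by the rows of an invertible matrix. -/
def rowBasis {G : Matrix (Fin n) (Fin n) ℝ} (hG : G.det ≠ 0) :
    Module.Basis (Fin n) ℝ (Fin n → ℝ) :=
  Module.Basis.mk (linearIndependent_of_det_ne_zero hG)
    ((linearIndependent_of_det_ne_zero hG).span_eq_top_of_card_eq_finrank' (by simp)).ge

lemma closure_range_eq_span {G : Matrix (Fin n) (Fin n) ℝ} (hG : G.det ≠ 0) :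
    AddSubgroup.closure (Set.range G) =
      (Submodule.span ℤ (Set.range (rowBasis hG))).toAddSubgroup := by
  have h : ⇑(rowBasis hG) = G := Module.Basis.coe_mk _ _
  rw [Submodule.span_int_eq_addSubgroupClosure, h]

lemma discreteTopology_closure_range {G : Matrix (Fin n) (Fin n) ℝ} (hG : G.det ≠ 0) :
    DiscreteTopology (AddSubgroup.closure (Set.range G)) := by
  rw [closure_range_eq_span hG]
  infer_instance

lemma card_eq_of_closure_spans {r : ℕ} {L : AddSubgroup (Fin n → ℝ)}
    (hL : Submodule.span ℝ (L : Set (Fin n → ℝ)) = ⊤) {v : Fin r → Fin n → ℝ}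
    (hv : LinearIndependent ℝ v) (h : L = AddSubgroup.closure (Set.range v)) : r = n := by
  have h1 : Submodule.span ℝ (Set.range v) = ⊤ := by
    refine top_le_iff.1 (hL ▸ Submodule.span_le.2 ?_)
    rw [h]
    exact (AddSubgroup.closure_le (Submodule.span ℝ (Set.range v)).toAddSubgroup).2
      Submodule.subset_span
  have h2 := finrank_span_eq_card hv
  rw [h1, finrank_top] at h2
  simpa using h2.symm

lemma covol_closure_range {G : Matrix (Fin n) (Fin n) ℝ} (hG : LinearIndependent ℝ G) :
    SW.covol (AddSubgroup.closure (Set.range G)) = |G.det| := by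
  have hspan := span_closure_range (det_ne_zero_of_linearIndependent hG)
  refine IsLeast.csInf_eq ⟨⟨n, G, hG, rfl, ?_⟩, ?_⟩
  · rw [gvol_eq_sqrt_gdet, sqrt_gdet_square]
  · rintro _ ⟨r, v, hv, hLv, rfl⟩
    obtain rfl := card_eq_of_closure_spans hspan hv hLv
    obtain ⟨w, rfl⟩ := exists_int_coords (G := G) (v := v) fun i => le_closure_of_eq hLv i
    rw [gvol_eq_sqrt_gdet, sqrt_gdet_square, Matrix.det_mul]
    have h1 : (w.map (Int.cast : ℤ → ℝ)).det = (w.det : ℝ) := (Int.cast_det w).symm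
    have h2 : w.det ≠ 0 := fun h => by
      refine det_ne_zero_of_linearIndependent (G := w.map (Int.cast : ℤ → ℝ) * G) hv ?_
      rw [Matrix.det_mul, h1, h, Int.cast_zero, zero_mul]
    have h3 : (1 : ℝ) ≤ |(w.det : ℝ)| := by exact_mod_cast Int.one_le_abs h2
    rw [abs_mul, h1]
    exact le_mul_of_one_le_left (abs_nonneg _) h3

lemma isStable_closure_range {G : Matrix (Fin n) (Fin n) ℝ} (hG : |G.det| = 1)
    (hw : ∀ (k : ℕ) (w : Matrix (Fin k) (Fin n) ℤ), LinearIndependent ℤ w → 1 ≤ latDet G w) :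
    SW.IsStable (AddSubgroup.closure (Set.range G)) := by
  have hG0 : G.det ≠ 0 := fun h => by simp [h] at hG
  exact ⟨⟨⟨discreteTopology_closure_range hG0, span_closure_range hG0⟩,
    (covol_closure_range (linearIndependent_of_det_ne_zero hG0)).trans hG⟩,
    fun Λ h => one_le_covol hG0 hw h⟩

/-- A unimodular lattice is spanned by the rows of a matrix of determinant `±1`. -/
lemma exists_matrix_of_isUnimodularLattice {L : AddSubgroup (Fin n → ℝ)}
    (hL : SW.IsUnimodularLattice L) :
    ∃ G : Matrix (Fin n) (Fin n) ℝ, |G.det| = 1 ∧ L = AddSubgroup.closure (Set.range G) := by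
  obtain ⟨⟨-, hspan⟩, hcov⟩ := hL
  have hne : {c | SW.covolSpec L c}.Nonempty := by
    by_contra h
    rw [Set.not_nonempty_iff_eq_empty] at h
    rw [SW.covol, h, Real.sInf_empty] at hcov
    exact zero_ne_one hcov
  obtain ⟨c, r, v, hv, hLv, rfl⟩ := hne
  obtain rfl := card_eq_of_closure_spans hspan hv hLv
  exact ⟨v, by rw [← covol_closure_range hv, ← hLv, hcov], hLv⟩

lemma enorm_le (x : Fin n → ℝ) : SW.enorm x ≤ Real.sqrt n * ‖x‖ := by
  rw [SW.enorm, ← Real.sqrt_sq (norm_nonneg x), ← Real.sqrt_mul (Nat.cast_nonneg n)]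
  refine Real.sqrt_le_sqrt ?_
  calc ∑ i, x i ^ 2 ≤ ∑ _i : Fin n, ‖x‖ ^ 2 :=
        Finset.sum_le_sum fun i _ => sq_le_sq.2 (by simpa using norm_le_pi_norm x i)
    _ = n * ‖x‖ ^ 2 := by simp

lemma bddBelow_enorm_sub (L : AddSubgroup (Fin n → ℝ)) (u : Fin n → ℝ) :
    BddBelow (Set.range fun v : L => SW.enorm (u - (v : Fin n → ℝ))) :=
  ⟨0, by rintro _ ⟨v, rfl⟩; exact Real.sqrt_nonneg _⟩

lemma iInf_enorm_le_covrad {G : Matrix (Fin n) (Fin n) ℝ} (hG : G.det ≠ 0) (u : Fin n → ℝ) :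
    ⨅ v : AddSubgroup.closure (Set.range G), SW.enorm (u - (v : Fin n → ℝ)) ≤
      SW.covrad (AddSubgroup.closure (Set.range G)) := by
  refine le_ciSup (f := fun u : Fin n → ℝ => ⨅ v : AddSubgroup.closure (Set.range G),
    SW.enorm (u - (v : Fin n → ℝ))) ⟨Real.sqrt n * ∑ i, ‖rowBasis hG i‖, ?_⟩ u
  rintro _ ⟨u, rfl⟩
  have hmem : (ZSpan.floor (rowBasis hG) u : Fin n → ℝ) ∈
      AddSubgroup.closure (Set.range G) := by
    rw [closure_range_eq_span hG]
    exact (ZSpan.floor (rowBasis hG) u).2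
  refine (ciInf_le (bddBelow_enorm_sub _ u) ⟨_, hmem⟩).trans ((enorm_le _).trans ?_)
  exact mul_le_mul_of_nonneg_left (ZSpan.norm_fract_le (rowBasis hG) u) (Real.sqrt_nonneg _)

/-- The inequality between geometric and quadratic means. -/
lemma abs_prod_le (hn : 0 < n) (x : Fin n → ℝ) :
    |∏ i, x i| ≤ (SW.enorm x / Real.sqrt n) ^ n := by
  have hn' : (0 : ℝ) < n := by exact_mod_cast hn
  have hn0 : (n : ℝ) ≠ 0 := hn'.ne'
  have h := Real.geom_mean_le_arith_mean_weighted Finset.univ (fun _ : Fin n => (1 / n : ℝ))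
    (fun i => x i ^ 2) (fun _ _ => by positivity) (by simp [hn0]) (fun _ _ => sq_nonneg _)
  have h1 := pow_le_pow_left₀ (Finset.prod_nonneg fun i _ => Real.rpow_nonneg (sq_nonneg (x i)) _)
    h n
  rw [← Finset.prod_pow] at h1
  have h2 : ∀ i, ((x i ^ 2) ^ (1 / n : ℝ)) ^ n = x i ^ 2 := fun i => by
    rw [one_div]
    exact Real.rpow_inv_natCast_pow (sq_nonneg _) hn.ne'
  simp only [h2, ← Finset.mul_sum] at h1
  refine abs_le_of_sq_le_sq ?_
    (pow_nonneg (div_nonneg (Real.sqrt_nonneg _) (Real.sqrt_nonneg _)) _)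
  rw [← Finset.prod_pow, ← pow_mul, mul_comm, pow_mul, div_pow, SW.enorm,
    Real.sq_sqrt (Finset.sum_nonneg fun _ _ => sq_nonneg _), Real.sq_sqrt hn'.le]
  refine h1.trans_eq ?_
  rw [one_div, inv_mul_eq_div]

lemma iInf_abs_prod_le_of_covrad_le (hn : 0 < n) {G : Matrix (Fin n) (Fin n) ℝ} (hG : G.det ≠ 0)
    {t : Fin n → ℝ} (ht : ∑ i, t i = 0)
    (hM : SW.covrad (AddSubgroup.closure (Set.range (G * diagonal fun j => Real.exp (t j)))) ≤
      Real.sqrt n / 2) (u : Fin n → ℝ) :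
    ⨅ v : AddSubgroup.closure (Set.range G), |∏ i, (u i - (v : Fin n → ℝ) i)| ≤ 1 / 2 ^ n := by
  set D : Matrix (Fin n) (Fin n) ℝ := diagonal fun j => Real.exp (t j) with hDdef
  have hD : (G * D).det ≠ 0 := by
    rw [det_mul_diagonal_exp]
    exact mul_ne_zero hG (Real.exp_ne_zero _)
  have hs : 0 < Real.sqrt n := Real.sqrt_pos.2 (by exact_mod_cast hn)
  have key : ∀ ε > 0, ⨅ v : AddSubgroup.closure (Set.range G),
      |∏ i, (u i - (v : Fin n → ℝ) i)| ≤ ((Real.sqrt n / 2 + ε) / Real.sqrt n) ^ n := by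
    intro ε hε
    have h1 : ⨅ v : AddSubgroup.closure (Set.range (G * D)),
        SW.enorm ((fun i => u i * Real.exp (t i)) - (v : Fin n → ℝ)) < Real.sqrt n / 2 + ε :=
      (iInf_enorm_le_covrad hD _).trans_lt (by linarith)
    obtain ⟨⟨v, hv⟩, hlt⟩ := exists_lt_of_ciInf_lt h1
    obtain ⟨m, rfl⟩ := mem_closure_range_iff.1 hv
    refine (ciInf_le ⟨0, ?_⟩ ⟨(fun i => (m i : ℝ)) ᵥ* G, mem_closure_range_iff.2 ⟨m, rfl⟩⟩).trans ?_
    · rintro _ ⟨v, rfl⟩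
      exact abs_nonneg _
    have h2 : ∏ i, (u i - ((fun i => (m i : ℝ)) ᵥ* G) i) =
        ∏ i, ((fun i => u i * Real.exp (t i)) - (fun i => (m i : ℝ)) ᵥ* (G * D)) i := by
      have h3 : ∏ i, Real.exp (t i) = 1 := by rw [← Real.exp_sum, ht, Real.exp_zero]
      rw [← mul_one (∏ i, (u i - ((fun i => (m i : ℝ)) ᵥ* G) i)), ← h3,
        ← Finset.prod_mul_distrib]
      refine Finset.prod_congr rfl fun i _ => ?_
      rw [← Matrix.vecMul_vecMul, Pi.sub_apply, hDdef, Matrix.vecMul_diagonal, sub_mul]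
    dsimp only
    rw [h2]
    refine (abs_prod_le hn _).trans (pow_le_pow_left₀
      (div_nonneg (Real.sqrt_nonneg _) hs.le) ?_ n)
    exact div_le_div_of_nonneg_right hlt.le hs.le
  have hlim : Tendsto (fun ε : ℝ => ((Real.sqrt n / 2 + ε) / Real.sqrt n) ^ n) (𝓝[>] 0)
      (𝓝 (((Real.sqrt n / 2 + 0) / Real.sqrt n) ^ n)) := by
    refine Tendsto.mono_left (Continuous.tendsto ?_ 0) nhdsWithin_le_nhds
    fun_prop
  have h5 : ((Real.sqrt n / 2 + 0) / Real.sqrt n) ^ n = 1 / 2 ^ n := by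
    rw [add_zero, div_right_comm, div_self hs.ne', div_pow, one_pow]
  rw [← h5]
  exact ge_of_tendsto hlim (eventually_mem_nhdsWithin.mono fun ε hε => key ε hε)

end stability

/-- **Corollary 5.1.** If every stable lattice in `ℒ_n` satisfies `covrad(x) ≤ √n/2`, then
Minkowski's conjecture holds in dimension `n`. -/
theorem SW.minkowski_of_stable_covrad_bound (n : ℕ) (hn : 2 ≤ n)
    (hstable : ∀ L : AddSubgroup (Fin n → ℝ), SW.IsStable L →
      SW.covrad L ≤ Real.sqrt n / 2) :
    ∀ L : AddSubgroup (Fin n → ℝ), SW.IsUnimodularLattice L →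
      ∀ u : Fin n → ℝ, (⨅ v : L, |∏ i, (u i - (v : Fin n → ℝ) i)|) ≤ 1 / 2 ^ n := by
  intro L hL u
  have hn0 : 0 < n := by omega
  obtain ⟨G, hG, rfl⟩ := exists_matrix_of_isUnimodularLattice hL
  have hG0 : G.det ≠ 0 := fun h => by simp [h] at hG
  obtain ⟨t, ht, hw⟩ := exists_diagonal_forall_one_le_latDet hn0 (G := G) (by
    rw [← sq_abs, hG, one_pow])
  refine iInf_abs_prod_le_of_covrad_le hn0 hG0 ht (hstable _ (isStable_closure_range ?_ hw)) u
  rw [det_mul_diagonal_exp, ht, Real.exp_zero, mul_one, hG]
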